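/- arXiv:2302.05997 — 11 statements merged into one kernel-verified Lean document; each statement's English description precedes it below -/
import Mathlib

section
/- Let C be a category and F : C ⥤ Cat a functor into the category of small categories. If C has all small colimits, every fiber F.obj c has all small colimits, and for every morphism f : c ⟶ c' of C the transition functor F.map f preserves small colimits, then the Grothendieck construction Grothendieck F has all small colimits. -/
open CategoryTheory CategoryTheory.Limits

universe w v u v₂ u₂

namespace GrothColim

section Gen

variable {A : Type u} [Category.{v} A]

lemma gen_loop {x y : A} (h : x = x) (f : x ⟶ y) : eqToHom h ≫ f = f := by simp

lemma gen_cancel {x x' y y' z : A} (p : x = x') (q : y = y') (q' : y' = y) (f : x' ⟶ y)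
    (g : y ⟶ z) : (eqToHom p ≫ f ≫ eqToHom q) ≫ eqToHom q' ≫ g = eqToHom p ≫ f ≫ g := by
  subst q; simp

lemma gen_iff {x x' y z : A} (p : x = x') (q : x' = x) (f : x' ⟶ y) (g : y ⟶ z) (k : x ⟶ z) :
    (eqToHom p ≫ f) ≫ g = k ↔ f ≫ g = eqToHom q ≫ k := by
  subst p; simp

end Gen

variable {C : Type u} [Category.{v} C] {F : C ⥤ Cat.{v₂, u₂}}

lemma obj_comp {a b c : C} (f : a ⟶ b) (t : b ⟶ c) (s : a ⟶ c) (h : f ≫ t = s) (x : F.obj a) :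
    (F.map s).toFunctor.obj x = (F.map t).toFunctor.obj ((F.map f).toFunctor.obj x) := by
  subst h; simp

lemma obj_id {a : C} (x : F.obj a) : (F.map (𝟙 a)).toFunctor.obj x = x := by
  simp

lemma map_comp_map {c d e : C} (f : c ⟶ d) (g : d ⟶ e) (s : c ⟶ e) (h : f ≫ g = s)
    {x y : F.obj c} (φ : x ⟶ y) :
    (F.map g).toFunctor.map ((F.map f).toFunctor.map φ) =
      eqToHom (obj_comp f g s h x).symm ≫ (F.map s).toFunctor.map φ ≫
        eqToHom (obj_comp f g s h y) := by
  subst h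
  have := Functor.congr_hom congr($(F.map_comp f g).toFunctor) φ
  rw [this]
  simp

/-- Push a morphism over `f` forward along `t`. -/
def push {a b c : C} {f : a ⟶ b} {x : F.obj a} {y : F.obj b}
    (φ : (F.map f).toFunctor.obj x ⟶ y) (t : b ⟶ c) (s : a ⟶ c) (h : f ≫ t = s) :
    (F.map s).toFunctor.obj x ⟶ (F.map t).toFunctor.obj y :=
  eqToHom (obj_comp f t s h x) ≫ (F.map t).toFunctor.map φ

lemma push_id {a c : C} (x : F.obj a) (s : a ⟶ c) (h : 𝟙 a ≫ s = s) :
    push (eqToHom (obj_id x)) s s h = 𝟙 _ := by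
  simp [push, eqToHom_map]

lemma push_comp {a b c e : C} {f : a ⟶ b} {g : b ⟶ c} {k : a ⟶ c} {x : F.obj a} {y : F.obj b}
    {z : F.obj c} (φ : (F.map f).toFunctor.obj x ⟶ y) (ψ : (F.map g).toFunctor.obj y ⟶ z)
    (hk : f ≫ g = k) (s : a ⟶ e) (t : b ⟶ e) (r : c ⟶ e)
    (h₁ : f ≫ t = s) (h₂ : g ≫ r = t) (h₃ : k ≫ r = s) :
    push (push φ g k hk ≫ ψ) r s h₃ = push φ t s h₁ ≫ push ψ r t h₂ := by
  simp [push, eqToHom_map, map_comp_map g r t h₂]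

lemma push_comp' {a b e c : C} {f : a ⟶ b} {t : b ⟶ e} {s : a ⟶ e} {u : e ⟶ c}
    {t' : b ⟶ c} {s' : a ⟶ c} {x : F.obj a} {y : F.obj b}
    (φ : (F.map f).toFunctor.obj x ⟶ y) (h : f ≫ t = s) (ht : t ≫ u = t') (hs : s ≫ u = s')
    (h' : f ≫ t' = s') :
    (F.map u).toFunctor.map (push φ t s h) =
      eqToHom (obj_comp s u s' hs x).symm ≫ push φ t' s' h' ≫ eqToHom (obj_comp t u t' ht y) := by
  simp [push, eqToHom_map, map_comp_map t u t' ht]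

lemma push_one {a b : C} {s : a ⟶ b} {x : F.obj a} {y : F.obj b}
    (φ : (F.map s).toFunctor.obj x ⟶ y) (h : s ≫ 𝟙 b = s) :
    push φ (𝟙 b) s h ≫ eqToHom (obj_id y) = φ := by
  have := Functor.congr_hom congr($(F.map_id b).toFunctor) φ
  simp [push, this]

lemma push_congr {a b c : C} {f f' : a ⟶ b} (hf : f = f') {x : F.obj a} {y : F.obj b}
    (φ : (F.map f).toFunctor.obj x ⟶ y) (φ' : (F.map f').toFunctor.obj x ⟶ y)
    (hφ : eqToHom (by rw [hf]) ≫ φ = φ') (t : b ⟶ c) (s : a ⟶ c) (h : f ≫ t = s)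
    (h' : f' ≫ t = s) : push φ t s h = push φ' t s h' := by
  subst hf
  subst hφ
  simp

lemma push_hom_congr {c : C} {X Y : Grothendieck F} {f g : X ⟶ Y} (hfg : f = g)
    (t : Y.base ⟶ c) (s : X.base ⟶ c) (h : f.base ≫ t = s) (h' : g.base ≫ t = s) :
    push f.fiber t s h = push g.fiber t s h' := by
  subst hfg; rfl

lemma comp_fiber' {X Y Z : Grothendieck F} (f : X ⟶ Y) (g : Y ⟶ Z) :
    (f ≫ g).fiber = push f.fiber g.base (f.base ≫ g.base) rfl ≫ g.fiber := by
  simp [push]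

/-- Two composable morphisms compose to a given one iff bases and fibers do. -/
lemma comp_eq_iff {X Y Z : Grothendieck F} (f : X ⟶ Y) (g : Y ⟶ Z) (k : X ⟶ Z)
    (h : f.base ≫ g.base = k.base) :
    f ≫ g = k ↔ push f.fiber g.base k.base h ≫ g.fiber = k.fiber := by
  obtain ⟨k, κ⟩ := k
  dsimp at h
  subst h
  constructor
  · intro e
    have := Grothendieck.congr e
    rw [comp_fiber'] at this
    exact this.trans (gen_loop _ _)
  · intro e
    refine Grothendieck.ext _ _ rfl ?_
    rw [comp_fiber']
    exact (gen_loop _ _).trans e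

variable {J : Type w} [Category.{w} J] (K : J ⥤ Grothendieck F)

/-- The diagram in the fiber over `c`. -/
def diag {c : C} (b : ∀ j, (K.obj j).base ⟶ c)
    (hb : ∀ {i j : J} (g : i ⟶ j), (K.map g).base ≫ b j = b i) : J ⥤ F.obj c where
  obj j := (F.map (b j)).toFunctor.obj (K.obj j).fiber
  map {i j} g := push (K.map g).fiber (b j) (b i) (hb g)
  map_id j := (push_hom_congr (K.map_id j) _ _ _ (Category.id_comp _)).trans
    (push_id _ _ _)
  map_comp {i j k} f g := by
    have h : (K.map f ≫ K.map g).base ≫ b k = b i := by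
      rw [← K.map_comp]; exact hb _
    refine (push_hom_congr (K.map_comp f g) _ _ _ h).trans ?_
    rw [← push_comp (K.map f).fiber (K.map g).fiber rfl (b i) (b j) (b k) (hb f) (hb g) h]
    congr 1
    exact comp_fiber' _ _

variable {c : C} (b : ∀ j, (K.obj j).base ⟶ c)
    (hb : ∀ {i j : J} (g : i ⟶ j), (K.map g).base ≫ b j = b i)

/-- The cocone in the Grothendieck construction. -/
def cocone (d : Cocone (diag K b hb)) : Cocone K where
  pt := ⟨c, d.pt⟩
  ι :=
    { app := fun j => ⟨b j, d.ι.app j⟩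
      naturality := fun i j g => by
        refine Eq.trans ?_ (Category.comp_id _).symm
        exact (comp_eq_iff (K.map g) (Y := K.obj j) (Z := ⟨c, d.pt⟩) ⟨b j, d.ι.app j⟩
          ⟨b i, d.ι.app i⟩ (hb g)).2 (d.w g) }

/-- The cocone in the fiber over the point of the target cocone. -/
def fiberCocone (s : Cocone K) (u : c ⟶ s.pt.base)
    (hu : ∀ j, b j ≫ u = (s.ι.app j).base) :
    Cocone (diag K b hb ⋙ (F.map u).toFunctor) where
  pt := s.pt.fiber
  ι :=
    { app := fun j => eqToHom (obj_comp (b j) u _ (hu j) (K.obj j).fiber).symm ≫ (s.ι.app j).fiber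
      naturality := fun i j g => by
        have hg : (K.map g).base ≫ (s.ι.app j).base = (s.ι.app i).base :=
          congrArg Grothendieck.Hom.base (s.w g)
        have h := (comp_eq_iff (K.map g) (s.ι.app j) (s.ι.app i) hg).1 (s.w g)
        refine Eq.trans ?_ (Category.comp_id _).symm
        change (F.map u).toFunctor.map (push (K.map g).fiber (b j) (b i) (hb g)) ≫ _ = _
        rw [push_comp' (K.map g).fiber (hb g) (hu j) (hu i) hg, ← h]
        exact gen_cancel _ _ _ _ _ }

lemma fac_iff (d : Cocone (diag K b hb)) (s : Cocone K) (u : c ⟶ s.pt.base)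
    (hu : ∀ j, b j ≫ u = (s.ι.app j).base) (φ : (F.map u).toFunctor.obj d.pt ⟶ s.pt.fiber)
    (j : J) :
    (cocone K b hb d).ι.app j ≫ (⟨u, φ⟩ : Grothendieck.Hom ⟨c, d.pt⟩ s.pt) = s.ι.app j ↔
      (F.map u).toFunctor.map (d.ι.app j) ≫ φ = (fiberCocone K b hb s u hu).ι.app j := by
  refine (comp_eq_iff (Y := ⟨c, d.pt⟩) ⟨b j, d.ι.app j⟩ ⟨u, φ⟩ (s.ι.app j) (hu j)).trans ?_
  exact gen_iff _ _ _ _ _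

/-- The cocone is colimiting. -/
def isColimit (b : Cocone (K ⋙ Grothendieck.forget F)) (hb : IsColimit b)
    (d : Cocone (diag K b.ι.app b.w))
    (hd : ∀ {c : C} (u : b.pt ⟶ c), IsColimit ((F.map u).toFunctor.mapCocone d)) :
    IsColimit (cocone K b.ι.app b.w d) where
  desc s := ⟨hb.desc ((Grothendieck.forget F).mapCocone s),
    (hd (hb.desc ((Grothendieck.forget F).mapCocone s))).desc
      (fiberCocone K b.ι.app b.w s _ (fun j => hb.fac ((Grothendieck.forget F).mapCocone s) j))⟩
  fac s j := (fac_iff K b.ι.app b.w d s _ (hb.fac ((Grothendieck.forget F).mapCocone s)) _ j).2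
    ((hd _).fac _ j)
  uniq s m hm := by
    obtain ⟨u, φ⟩ := m
    have hu : ∀ j, b.ι.app j ≫ u = (s.ι.app j).base :=
      fun j => congrArg Grothendieck.Hom.base (hm j)
    obtain rfl : u = hb.desc ((Grothendieck.forget F).mapCocone s) := hb.uniq
      ((Grothendieck.forget F).mapCocone s) u hu
    congr 1
    exact (hd _).uniq (fiberCocone K b.ι.app b.w s _ hu) φ fun j =>
      (fac_iff K b.ι.app b.w d s _ hu φ j).1 (hm j)

end GrothColim

/-- If `C` has all small colimits, every fiber `F.obj c` has all small
colimits, and every transition functor `F.map f` preserves small colimits, then the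
Grothendieck construction `Grothendieck F` has all small colimits. -/
theorem grothendieck_hasColimits {C : Type u} [Category.{v} C] (F : C ⥤ Cat.{v₂, u₂})
    [HasColimitsOfSize.{w, w} C]
    [∀ c : C, HasColimitsOfSize.{w, w} (F.obj c)]
    [∀ {c c' : C} (f : c ⟶ c'), PreservesColimitsOfSize.{w, w} (F.map f).toFunctor] :
    HasColimitsOfSize.{w, w} (Grothendieck F) := by
  refine ⟨fun J _ => ⟨fun K => ⟨⟨⟨_, GrothColim.isColimit K
    (colimit.cocone (K ⋙ Grothendieck.forget F)) (colimit.isColimit _)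
    (colimit.cocone (GrothColim.diag K _ _)) (fun u => ?_)⟩⟩⟩⟩⟩
  exact isColimitOfPreserves (F.map u).toFunctor (colimit.isColimit _)
end

section
/- Let C be a category and F : C ⥤ Cat a functor into the category of small categories such that C has all small colimits, every fiber F.obj c has all small colimits, and every transition functor F.map f preserves small colimits. Then the projection functor Grothendieck.forget F : Grothendieck F ⥤ C preserves all small colimits. -/
open CategoryTheory CategoryTheory.Limits

universe w v u v₂ u₂

namespace GrothAux

variable {C : Type u} [Category.{v} C] {F : C ⥤ Cat.{v₂, u₂}}

/-- The morphism in the fiber over `d` induced by a morphism of the Grothendieck construction. -/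
def push {X Y : Grothendieck F} {d : C} (m : X ⟶ Y) (t : Y.base ⟶ d) (t' : X.base ⟶ d)
    (h : m.base ≫ t = t') :
    (F.map t').toFunctor.obj X.fiber ⟶ (F.map t).toFunctor.obj Y.fiber :=
  eqToHom (by subst h; simp) ≫ (F.map t).toFunctor.map m.fiber

/-- Morphism constructor. -/
def mkHom {X : Grothendieck F} {d : C} {y : F.obj d} (t : X.base ⟶ d)
    (φ : (F.map t).toFunctor.obj X.fiber ⟶ y) : X ⟶ (⟨d, y⟩ : Grothendieck F) := ⟨t, φ⟩

lemma mkHom_inj {X : Grothendieck F} {d : C} {y : F.obj d} (t : X.base ⟶ d)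
    {φ ψ : (F.map t).toFunctor.obj X.fiber ⟶ y} (h : mkHom t φ = mkHom t ψ) : φ = ψ := by
  unfold mkHom at h
  injection h

lemma comp_mkHom {X Y : Grothendieck F} {d : C} {y : F.obj d} (m : X ⟶ Y) (t : Y.base ⟶ d)
    (t' : X.base ⟶ d) (h : m.base ≫ t = t') (φ : (F.map t).toFunctor.obj Y.fiber ⟶ y) :
    m ≫ mkHom t φ = mkHom t' (push m t t' h ≫ φ) := by
  subst h
  refine Grothendieck.ext _ _ rfl ?_
  simp [mkHom, push]
  exact Category.id_comp _

lemma push_id {X : Grothendieck F} {d : C} (t : X.base ⟶ d) (h : (𝟙 X : X ⟶ X).base ≫ t = t) :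
    push (𝟙 X) t t h = 𝟙 _ := by
  apply mkHom_inj
  have := comp_mkHom (𝟙 X) t t h (𝟙 _)
  rw [Category.id_comp, Category.comp_id] at this
  exact this.symm

lemma push_comp {X Y Z : Grothendieck F} {d : C} (m : X ⟶ Y) (n : Y ⟶ Z) (t : Z.base ⟶ d)
    (t' : Y.base ⟶ d) (t'' : X.base ⟶ d) (h : n.base ≫ t = t') (h' : m.base ≫ t' = t'')
    (h'' : (m ≫ n).base ≫ t = t'') :
    push (m ≫ n) t t'' h'' = push m t' t'' h' ≫ push n t t' h := by
  apply mkHom_inj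
  have h1 := comp_mkHom (m ≫ n) t t'' h'' (𝟙 _)
  rw [Category.assoc, comp_mkHom n t t' h, comp_mkHom m t' t'' h'] at h1
  simpa using h1.symm

lemma push_comp_of_eq {X Y Z : Grothendieck F} {d : C} (m : X ⟶ Y) (n : Y ⟶ Z) (p : X ⟶ Z)
    (hp : m ≫ n = p) (t : Z.base ⟶ d)
    (t' : Y.base ⟶ d) (t'' : X.base ⟶ d) (h : n.base ≫ t = t') (h' : m.base ≫ t' = t'')
    (h'' : p.base ≫ t = t'') :
    push m t' t'' h' ≫ push n t t' h = push p t t'' h'' := by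
  subst hp
  exact (push_comp ..).symm

variable {J : Type w} [Category.{w} J] (K : J ⥤ Grothendieck F)

/-- The diagram in the fiber over the point of a cocone in the base. -/
def diag (s : Cocone (K ⋙ Grothendieck.forget F)) : J ⥤ F.obj s.pt where
  obj j := (F.map (s.ι.app j)).toFunctor.obj (K.obj j).fiber
  map {i j} g := push (K.map g) (s.ι.app j) (s.ι.app i) (s.w g)
  map_id j := by
    have : ∀ (m : K.obj j ⟶ K.obj j) (_ : m = 𝟙 _) (h : m.base ≫ s.ι.app j = s.ι.app j),
        push m (s.ι.app j) (s.ι.app j) h = 𝟙 _ := by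
      rintro _ rfl h
      exact push_id _ h
    exact this _ (K.map_id j) _
  map_comp f g := (push_comp_of_eq _ _ _ (K.map_comp f g).symm _ _ _ _ _ _).symm

/-- A cocone over a diagram `K` with prescribed base. -/
def liftCocone (s : Cocone (K ⋙ Grothendieck.forget F)) (t : Cocone (diag K s)) : Cocone K where
  pt := ⟨s.pt, t.pt⟩
  ι :=
    { app := fun j => mkHom (s.ι.app j) (t.ι.app j)
      naturality := fun i j g => by
        have h1 := comp_mkHom (K.map g) (s.ι.app j) (s.ι.app i) (s.w g) (t.ι.app j)
        have h2 : push (K.map g) (s.ι.app j) (s.ι.app i) (s.w g) ≫ t.ι.app j = t.ι.app i := t.w g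
        rw [h2] at h1
        exact h1.trans (Category.comp_id _).symm }

/-- Comparison cocone in the fiber. -/
def pushCocone (s : Cocone (K ⋙ Grothendieck.forget F)) (c : Cocone K) (f : c.pt.base ⟶ s.pt)
    (hf : ∀ j, (c.ι.app j).base ≫ f = s.ι.app j) : Cocone (diag K s) where
  pt := (F.map f).toFunctor.obj c.pt.fiber
  ι :=
    { app := fun j => push (c.ι.app j) f (s.ι.app j) (hf j)
      naturality := fun _ _ g =>
        (push_comp_of_eq _ _ _ (c.w g) _ _ _ _ (s.w g) _).trans (Category.comp_id _).symm }

lemma hom_eq [∀ c : C, HasColimitsOfSize.{w, w} (F.obj c)]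
    (s : Cocone (K ⋙ Grothendieck.forget F)) (c : Cocone K) (hc : IsColimit c)
    (f g : c.pt.base ⟶ s.pt) (hf : ∀ j, (c.ι.app j).base ≫ f = s.ι.app j)
    (hg : ∀ j, (c.ι.app j).base ≫ g = s.ι.app j) : f = g := by
  have : HasPushouts (F.obj s.pt) :=
    (hasColimitsOfSizeShrink.{0, 0, w, w} (F.obj s.pt)).has_colimits_of_shape _
  let a : colimit (diag K s) ⟶ (F.map f).toFunctor.obj c.pt.fiber :=
    colimit.desc _ (pushCocone K s c f hf)
  let b : colimit (diag K s) ⟶ (F.map g).toFunctor.obj c.pt.fiber :=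
    colimit.desc _ (pushCocone K s c g hg)
  have key : mkHom f (pushout.inl a b) = mkHom g (pushout.inr a b) := by
    refine hc.hom_ext fun j => ?_
    rw [comp_mkHom _ f _ (hf j), comp_mkHom _ g _ (hg j)]
    congr 1
    have h1 : colimit.ι (diag K s) j ≫ a = push (c.ι.app j) f (s.ι.app j) (hf j) :=
      colimit.ι_desc _ _
    have h2 : colimit.ι (diag K s) j ≫ b = push (c.ι.app j) g (s.ι.app j) (hg j) :=
      colimit.ι_desc _ _
    rw [← h1, ← h2]
    exact (Category.assoc _ _ _).trans
      ((congrArg (fun z => colimit.ι (diag K s) j ≫ z) pushout.condition).trans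
        (Category.assoc _ _ _).symm)
  exact congrArg Grothendieck.Hom.base key

end GrothAux

open GrothAux in
/-- Under the same hypotheses as Statement 0, the projection functor
`Grothendieck.forget F : Grothendieck F ⥤ C` preserves all small colimits. -/
theorem grothendieck_forget_preservesColimits {C : Type u} [Category.{v} C]
    (F : C ⥤ Cat.{v₂, u₂})
    [HasColimitsOfSize.{w, w} C]
    [∀ c : C, HasColimitsOfSize.{w, w} (F.obj c)]
    [∀ {c c' : C} (f : c ⟶ c'), PreservesColimitsOfSize.{w, w} (F.map f).toFunctor] :
    PreservesColimitsOfSize.{w, w} (Grothendieck.forget F) := by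
  refine ⟨fun {J} _ => ⟨fun {K} => ⟨fun {c} hc => ⟨?_⟩⟩⟩⟩
  have fac : ∀ (s : Cocone (K ⋙ Grothendieck.forget F)) (j : J),
      (c.ι.app j).base ≫ (hc.desc (liftCocone K s (colimit.cocone (diag K s)))).base
        = s.ι.app j := fun s j =>
    congrArg Grothendieck.Hom.base (hc.fac (liftCocone K s (colimit.cocone (diag K s))) j)
  exact
    { desc := fun s => (hc.desc (liftCocone K s (colimit.cocone (diag K s)))).base
      fac := fac
      uniq := fun s m hm => hom_eq K s c hc _ _ hm (fac s) }
end

section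
/- Let C be a category with all small limits and all small colimits, and let F : C ⥤ Cat be a functor into the category of small categories such that every fiber F.obj c has all small limits and all small colimits and every transition functor F.map f (for f a morphism of C) is a left adjoint (i.e., possesses a right adjoint). Then the Grothendieck construction Grothendieck F has all small limits and all small colimits. -/
open CategoryTheory CategoryTheory.Limits

universe w v u v₂ u₂

/-- Abstract construction of colimits in a category over a base with cocartesian pushforwards and
relative colimits in the fibres. -/
theorem hasColimit_of_relative {C : Type*} [Category C] {E : Type*} [Category E] (p : E ⥤ C)
    {Fib : C → Type*} [∀ c, Category (Fib c)] (inc : ∀ c, Fib c ⥤ E)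
    (e : ∀ c (x : Fib c), p.obj ((inc c).obj x) ≅ c)
    (he : ∀ c (x y : Fib c) (φ : x ⟶ y), p.map ((inc c).map φ) = (e c x).hom ≫ (e c y).inv)
    (ff : ∀ c (x y : Fib c) (k : (inc c).obj x ⟶ (inc c).obj y),
      p.map k = (e c x).hom ≫ (e c y).inv → ∃ φ : x ⟶ y, (inc c).map φ = k)
    (faith : ∀ c (x y : Fib c) (φ ψ : x ⟶ y), (inc c).map φ = (inc c).map ψ → φ = ψ)
    (push : ∀ (X : E) (c : C) (f : p.obj X ⟶ c), ∃ (x : Fib c) (η : X ⟶ (inc c).obj x),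
      p.map η = f ≫ (e c x).inv ∧ ∀ (Z : E) (h : X ⟶ Z) (g : c ⟶ p.obj Z),
        p.map h = f ≫ g → ∃! k : (inc c).obj x ⟶ Z, p.map k = (e c x).hom ≫ g ∧ η ≫ k = h)
    {J : Type*} [Category J] [HasColimitsOfShape J C]
    (rel : ∀ (c : C) (D : J ⥤ Fib c), ∃ t : Cocone D, ∀ (Z : E) (g : c ⟶ p.obj Z)
      (h : ∀ j, (inc c).obj (D.obj j) ⟶ Z), (∀ j, p.map (h j) = (e c _).hom ≫ g) →
      (∀ i j (a : i ⟶ j), (inc c).map (D.map a) ≫ h j = h i) →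
      ∃! k : (inc c).obj t.pt ⟶ Z, p.map k = (e c _).hom ≫ g ∧
        ∀ j, (inc c).map (t.ι.app j) ≫ k = h j) :
    HasColimitsOfShape J E := by
  refine ⟨fun G => ?_⟩
  let c := colimit (G ⋙ p)
  let i : ∀ j, p.obj (G.obj j) ⟶ c := fun j => colimit.ι (G ⋙ p) j
  have hi : ∀ {j k} (a : j ⟶ k), p.map (G.map a) ≫ i k = i j :=
    fun a => colimit.w (G ⋙ p) a
  choose d η hη hu using fun j => push (G.obj j) c (i j)
  have uniq : ∀ j {Z : E} (g : c ⟶ p.obj Z) (k k' : (inc c).obj (d j) ⟶ Z),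
      p.map k = (e c _).hom ≫ g → p.map k' = (e c _).hom ≫ g → η j ≫ k = η j ≫ k' → k = k' := by
    intro j Z g k k' h1 h2 h3
    exact (hu j Z (η j ≫ k) g (by simp [hη, h1])).unique ⟨h1, rfl⟩ ⟨h2, h3.symm⟩
  have ex : ∀ {j k} (a : j ⟶ k), ∃ φ : d j ⟶ d k, η j ≫ (inc c).map φ = G.map a ≫ η k := by
    intro j k a
    obtain ⟨m, ⟨hm1, hm2⟩, -⟩ := hu j _ (G.map a ≫ η k) (e c (d k)).inv
      (by rw [p.map_comp, hη, ← Category.assoc, hi])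
    obtain ⟨φ, rfl⟩ := ff c _ _ m hm1
    exact ⟨φ, hm2⟩
  choose dm hdm using @ex
  have uf : ∀ {j k} (φ ψ : d j ⟶ d k), η j ≫ (inc c).map φ = η j ≫ (inc c).map ψ → φ = ψ :=
    fun {j k} φ ψ h => faith c _ _ _ _ (uniq j (e c (d k)).inv _ _ (he _ _ _ _) (he _ _ _ _) h)
  let D : J ⥤ Fib c :=
    { obj := d
      map := fun a => dm a
      map_id := fun j => uf _ _ (by simp [hdm])
      map_comp := fun a b => uf _ _ (by
        rw [hdm, Functor.map_comp, Functor.map_comp, ← Category.assoc (η _), hdm, Category.assoc,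
          Category.assoc, hdm]) }
  obtain ⟨t, ht⟩ := rel c D
  let T : Cocone G :=
    { pt := (inc c).obj t.pt
      ι :=
        { app := fun j => η j ≫ (inc c).map (t.ι.app j)
          naturality := fun j k a => by
            have h1 : dm a ≫ t.ι.app k = t.ι.app j := t.w a
            have h2 : G.map a ≫ η k ≫ (inc c).map (t.ι.app k) = η j ≫ (inc c).map (t.ι.app j) := by
              rw [← Category.assoc, ← hdm, Category.assoc, ← Functor.map_comp, h1]
            simpa using h2 } }
  have key : ∀ s : Cocone G, ∃! k : T.pt ⟶ s.pt, ∀ j, T.ι.app j ≫ k = s.ι.app j := by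
    intro s
    let g : c ⟶ p.obj s.pt := colimit.desc (G ⋙ p) (p.mapCocone s)
    have hg : ∀ j, i j ≫ g = p.map (s.ι.app j) := fun j => colimit.ι_desc (p.mapCocone s) j
    choose h hh _ using fun j => hu j s.pt (s.ι.app j) g (hg j).symm
    obtain ⟨k, ⟨hk1, hk2⟩, hk3⟩ := ht s.pt g h (fun j => (hh j).1) (by
      intro j k a
      refine uniq j g _ _ ?_ (hh j).1 ?_
      · rw [p.map_comp, he]
        erw [(hh k).1]
        simp
        rfl
      · rw [(hh j).2, ← Category.assoc]
        erw [hdm]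
        rw [Category.assoc]
        erw [(hh k).2]
        exact s.w a)
    refine ⟨k, fun j => ?_, fun m hm => hk3 m ?_⟩
    · change (η j ≫ (inc c).map (t.ι.app j)) ≫ k = _
      rw [Category.assoc, hk2, (hh j).2]
    · have hm' : ∀ j, η j ≫ (inc c).map (t.ι.app j) ≫ m = s.ι.app j := fun j => by
        rw [← Category.assoc]; exact hm j
      have pm : p.map m = (e c _).hom ≫ g := by
        rw [← Iso.inv_comp_eq]
        refine colimit.hom_ext fun j => ?_
        change i j ≫ _ = i j ≫ g
        rw [hg, ← hm' j, p.map_comp, p.map_comp, hη, he]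
        simp
      refine ⟨pm, fun j => uniq j g _ _ ?_ (hh j).1 ?_⟩
      · rw [p.map_comp, he, pm]
        simp
        rfl
      · rw [hm', (hh j).2]
  choose k hk hk' using key
  exact ⟨⟨T, { desc := k, fac := hk, uniq := fun s m hm => hk' s m hm }⟩⟩

section
variable {C : Type u} [Category.{v} C] (F : C ⥤ Cat.{v₂, u₂})

theorem groth_aux1 {D E : Type*} [Category D] [Category E] (G : D ⥤ E) {a b y : D} {x₁ x₂ t : E}
    (h1 : x₁ = x₂) (h2 : x₂ = G.obj a) (h3 : a = b) (h4 : x₁ = G.obj b) (φ : b ⟶ y)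
    (k : G.obj y ⟶ t) : eqToHom h1 ≫ eqToHom h2 ≫ G.map (eqToHom h3 ≫ φ) ≫ k =
      eqToHom h4 ≫ G.map φ ≫ k := by
  subst h3 h2 h1
  simp

theorem groth_aux2 {D : Type*} [Category D] (G : D ⥤ D) (hG : G = 𝟭 D) {z x y x₁ : D}
    (h1 : z = x₁) (h2 : x₁ = G.obj z) (h3 : G.obj x = x) (k : z ⟶ x) (φ : x ⟶ y) :
    eqToHom h1 ≫ eqToHom h2 ≫ G.map k ≫ eqToHom h3 ≫ φ = k ≫ φ := by
  subst hG
  subst h1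
  simp

theorem groth_aux3 {D : Type*} [Category D] {a b y : D} (h1 : a = b) (h2 : b = a)
    (φ : a ⟶ y) : eqToHom h1 ≫ eqToHom h2 ≫ φ = φ := by
  subst h1
  simp

/-- Constructor for morphisms. -/
abbrev gmk {X Y : Grothendieck F} (g : X.base ⟶ Y.base)
    (φ : (F.map g).toFunctor.obj X.fiber ⟶ Y.fiber) : X ⟶ Y := ⟨g, φ⟩

theorem groth_hom_cases {X Y : Grothendieck F} (h : X ⟶ Y) (g : X.base ⟶ Y.base)
    (hg : h.base = g) : ∃ φ : (F.map g).toFunctor.obj X.fiber ⟶ Y.fiber, h = gmk F g φ := by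
  subst hg
  exact ⟨h.fiber, rfl⟩

theorem groth_mk_inj {X Y : Grothendieck F} (g : X.base ⟶ Y.base)
    (φ ψ : (F.map g).toFunctor.obj X.fiber ⟶ Y.fiber)
    (h : (gmk F (X := X) (Y := Y) (g) (φ)) = ⟨g, ψ⟩) : φ = ψ := by
  injection h

theorem groth_ι_comp {c : C} {x y : F.obj c} (φ : x ⟶ y) (Z : Grothendieck F) (g : c ⟶ Z.base)
    (k : (F.map g).toFunctor.obj y ⟶ Z.fiber) :
    (Grothendieck.ι F c).map φ ≫ (gmk F (X := ((Grothendieck.ι F c).obj y)) (Y := Z) (g) (k)) =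
      (gmk F (X := ((Grothendieck.ι F c).obj x)) (Y := Z) (g) ((F.map g).toFunctor.map φ ≫ k)) := by
  refine Grothendieck.ext _ _ (Category.id_comp g) ?_
  change eqToHom _ ≫ eqToHom _ ≫ (F.map g).toFunctor.map (eqToHom _ ≫ φ) ≫ k = _
  exact (groth_aux1 (F.map g).toFunctor _ _ _ rfl φ k).trans (Category.id_comp _)

theorem groth_comp_ι {c : C} {x y : F.obj c} (φ : x ⟶ y) (Z : Grothendieck F) (g : Z.base ⟶ c)
    (k : (F.map g).toFunctor.obj Z.fiber ⟶ x) :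
    (gmk F (X := Z) (Y := ((Grothendieck.ι F c).obj x)) (g) (k)) ≫ (Grothendieck.ι F c).map φ =
      (gmk F (X := Z) (Y := ((Grothendieck.ι F c).obj y)) (g) (k ≫ φ)) := by
  refine Grothendieck.ext _ _ (Category.comp_id g) ?_
  change eqToHom _ ≫ eqToHom _ ≫ (F.map (𝟙 c)).toFunctor.map k ≫ eqToHom _ ≫ φ = k ≫ φ
  exact groth_aux2 (F.map (𝟙 c)).toFunctor congr($(F.map_id c).toFunctor) _ _ _ k φ

theorem groth_ff (c : C) (x y : F.obj c)
    (k : (Grothendieck.ι F c).obj x ⟶ (Grothendieck.ι F c).obj y) (hk : k.base = 𝟙 c) :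
    ∃ φ : x ⟶ y, (Grothendieck.ι F c).map φ = k := by
  obtain ⟨φ, rfl⟩ := groth_hom_cases F k _ hk
  refine ⟨eqToHom congr($(F.map_id c).toFunctor.obj x).symm ≫ φ, ?_⟩
  refine Grothendieck.ext _ _ rfl ?_
  exact (Category.id_comp _).trans (groth_aux3 _ _ φ)

theorem groth_push (X : Grothendieck F) (c : C) (f : X.base ⟶ c) :
    ∃ (x : F.obj c) (η : X ⟶ (Grothendieck.ι F c).obj x),
      η.base = f ∧ ∀ (Z : Grothendieck F) (h : X ⟶ Z) (g : c ⟶ Z.base),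
        h.base = f ≫ g → ∃! k : (Grothendieck.ι F c).obj x ⟶ Z, k.base = g ∧ η ≫ k = h := by
  refine ⟨(F.map f).toFunctor.obj X.fiber, ⟨f, 𝟙 _⟩, rfl, fun Z h g hh => ?_⟩
  obtain ⟨φ, rfl⟩ := groth_hom_cases F h _ hh
  have key : ∀ k : (F.map g).toFunctor.obj ((F.map f).toFunctor.obj X.fiber) ⟶ Z.fiber,
      (gmk F (X := X) (Y := ((Grothendieck.ι F c).obj _)) (f) (𝟙 _)) ≫
        (gmk F (X := ((Grothendieck.ι F c).obj _)) (Y := Z) (g) (k)) =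
      (gmk F (X := X) (Y := Z) (f ≫ g) (eqToHom (by simp) ≫ k)) := by
    intro k
    refine Grothendieck.ext _ _ rfl ?_
    change 𝟙 _ ≫ eqToHom _ ≫ (F.map g).toFunctor.map (𝟙 _) ≫ k = eqToHom _ ≫ k
    simp
  have hfg : (F.map g).toFunctor.obj ((F.map f).toFunctor.obj X.fiber) =
    (F.map (f ≫ g)).toFunctor.obj X.fiber := by simp
  refine ⟨gmk F g (eqToHom hfg ≫ φ), ⟨rfl, ?_⟩, ?_⟩
  · refine (key _).trans ?_
    exact congrArg (gmk F (f ≫ g)) (groth_aux3 _ _ φ)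
  · rintro k ⟨hk, hk2⟩
    obtain ⟨k, rfl⟩ := groth_hom_cases F k _ hk
    have := groth_mk_inj F _ _ _ ((key k).symm.trans hk2)
    subst this
    exact congrArg (gmk F (X := (Grothendieck.ι F c).obj ((F.map f).toFunctor.obj X.fiber)) (Y := Z) g)
      (groth_aux3 _ _ k).symm

theorem groth_pull (X : Grothendieck F) (c : C) (f : c ⟶ X.base)
    (_ : (F.map f).toFunctor.IsLeftAdjoint) :
    ∃ (x : F.obj c) (η : (Grothendieck.ι F c).obj x ⟶ X),
      η.base = f ∧ ∀ (Z : Grothendieck F) (h : Z ⟶ X) (g : Z.base ⟶ c),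
        h.base = g ≫ f → ∃! k : Z ⟶ (Grothendieck.ι F c).obj x, k.base = g ∧ k ≫ η = h := by
  let adj := Adjunction.ofIsLeftAdjoint (F.map f).toFunctor
  refine ⟨(F.map f).toFunctor.rightAdjoint.obj X.fiber, ⟨f, adj.counit.app X.fiber⟩, rfl,
    fun Z h g hh => ?_⟩
  obtain ⟨φ, rfl⟩ := groth_hom_cases F h _ hh
  have key : ∀ k : (F.map g).toFunctor.obj Z.fiber ⟶
        (F.map f).toFunctor.rightAdjoint.obj X.fiber,
      (gmk F (X := Z) (Y := ((Grothendieck.ι F c).obj _)) (g) (k)) ≫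
        (gmk F (X := ((Grothendieck.ι F c).obj _)) (Y := X) (f) (adj.counit.app X.fiber)) =
      (gmk F (X := Z) (Y := X) (g ≫ f) (eqToHom (by simp) ≫ (adj.homEquiv _ _).symm k)) := by
    intro k
    rw [Adjunction.homEquiv_counit]
    rfl
  have hfg : (F.map f).toFunctor.obj ((F.map g).toFunctor.obj Z.fiber) =
    (F.map (g ≫ f)).toFunctor.obj Z.fiber := by simp
  refine ⟨gmk F g (adj.homEquiv _ _ (eqToHom hfg ≫ φ)), ⟨rfl, ?_⟩, ?_⟩
  · refine (key _).trans ?_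
    refine congrArg (gmk F (g ≫ f)) (Eq.trans ?_ (groth_aux3 hfg.symm hfg φ))
    exact congrArg (fun z => eqToHom hfg.symm ≫ z) (Equiv.symm_apply_apply (adj.homEquiv _ _) _)
  · rintro k ⟨hk, hk2⟩
    obtain ⟨k, rfl⟩ := groth_hom_cases F k _ hk
    have := groth_mk_inj F _ _ _ ((key k).symm.trans hk2)
    subst this
    refine congrArg (gmk F (X := Z) (Y := (Grothendieck.ι F c).obj
      ((F.map f).toFunctor.rightAdjoint.obj X.fiber)) g) ?_
    refine ((congrArg (adj.homEquiv _ _) (groth_aux3 _ _ _)).trans ?_).symm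
    exact Equiv.apply_symm_apply (adj.homEquiv _ _) k

theorem groth_rel_colim {J : Type*} [Category J] (c : C) (D : J ⥤ F.obj c) (t : Cocone D)
    (ht : IsColimit t) (Z : Grothendieck F) (g : c ⟶ Z.base)
    (_ : PreservesColimit D (F.map g).toFunctor)
    (h : ∀ j, (Grothendieck.ι F c).obj (D.obj j) ⟶ Z) (hb : ∀ j, (h j).base = g)
    (hc : ∀ i j (a : i ⟶ j), (Grothendieck.ι F c).map (D.map a) ≫ h j = h i) :
    ∃! k : (Grothendieck.ι F c).obj t.pt ⟶ Z, k.base = g ∧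
      ∀ j, (Grothendieck.ι F c).map (t.ι.app j) ≫ k = h j := by
  choose φ hφ using fun j => groth_hom_cases F (h j) g (hb j)
  obtain rfl : h = _ := funext hφ
  have ht' := isColimitOfPreserves (F.map g).toFunctor ht
  let s : Cocone (D ⋙ (F.map g).toFunctor) :=
    { pt := Z.fiber
      ι := { app := φ
             naturality := fun i j a => by
              have := groth_mk_inj F _ _ _ ((groth_ι_comp F (D.map a) Z g (φ j)).symm.trans
                (hc i j a))
              exact this.trans (Category.comp_id _).symm } }
  refine ⟨⟨g, ht'.desc s⟩, ⟨rfl, fun j => ?_⟩, ?_⟩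
  · refine (groth_ι_comp F _ Z g _).trans ?_
    congr 1
    exact ht'.fac s j
  · rintro k ⟨hk, hk2⟩
    obtain ⟨k, rfl⟩ := groth_hom_cases F k _ hk
    congr 1
    refine ht'.uniq s k fun j => ?_
    exact groth_mk_inj F _ _ _ ((groth_ι_comp F (t.ι.app j) Z g k).symm.trans (hk2 j))

theorem groth_rel_lim {J : Type*} [Category J] (c : C) (D : J ⥤ F.obj c) (t : Cone D)
    (ht : IsLimit t) (Z : Grothendieck F) (g : Z.base ⟶ c)
    (h : ∀ j, Z ⟶ (Grothendieck.ι F c).obj (D.obj j)) (hb : ∀ j, (h j).base = g)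
    (hc : ∀ i j (a : i ⟶ j), h i ≫ (Grothendieck.ι F c).map (D.map a) = h j) :
    ∃! k : Z ⟶ (Grothendieck.ι F c).obj t.pt, k.base = g ∧
      ∀ j, k ≫ (Grothendieck.ι F c).map (t.π.app j) = h j := by
  choose φ hφ using fun j => groth_hom_cases F (h j) g (hb j)
  obtain rfl : h = _ := funext hφ
  let s : Cone D :=
    { pt := (F.map g).toFunctor.obj Z.fiber
      π := { app := φ
             naturality := fun i j a => by
              have := groth_mk_inj F _ _ _ ((groth_comp_ι F (D.map a) Z g (φ i)).symm.trans
                (hc i j a))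
              exact (Category.id_comp _).trans this.symm } }
  refine ⟨⟨g, ht.lift s⟩, ⟨rfl, fun j => ?_⟩, ?_⟩
  · refine (groth_comp_ι F _ Z g _).trans ?_
    congr 1
    exact ht.fac s j
  · rintro k ⟨hk, hk2⟩
    obtain ⟨k, rfl⟩ := groth_hom_cases F k _ hk
    congr 1
    refine ht.uniq s k fun j => ?_
    exact groth_mk_inj F _ _ _ ((groth_comp_ι F (t.π.app j) Z g k).symm.trans (hk2 j))

end

/-- If `C` has all small limits and colimits, every fiber `F.obj c` has all
small limits and colimits, and every transition functor `F.map f` is a left adjoint, then the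
Grothendieck construction `Grothendieck F` has all small limits and all small colimits. -/
theorem grothendieck_hasLimits_hasColimits_of_isLeftAdjoint {C : Type u} [Category.{v} C]
    (F : C ⥤ Cat.{v₂, u₂})
    [HasLimitsOfSize.{w, w} C] [HasColimitsOfSize.{w, w} C]
    [∀ c : C, HasLimitsOfSize.{w, w} (F.obj c)]
    [∀ c : C, HasColimitsOfSize.{w, w} (F.obj c)]
    [∀ {c c' : C} (f : c ⟶ c'), (F.map f).toFunctor.IsLeftAdjoint] :
    HasLimitsOfSize.{w, w} (Grothendieck F) ∧ HasColimitsOfSize.{w, w} (Grothendieck F) := by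
  rename_i inst
  constructor
  · have : HasColimitsOfSize.{w, w} (Grothendieck F)ᵒᵖ := by
      refine ⟨fun J _ => ?_⟩
      refine hasColimit_of_relative (Grothendieck.forget F).op
        (Fib := fun c => (F.obj c.unop)ᵒᵖ) (fun c => (Grothendieck.ι F c.unop).op)
        (fun c x => Iso.refl c) ?_ ?_ ?_ ?_ ?_
      · intro c x y φ
        exact (Category.comp_id (𝟙 c)).symm
      · intro c x y k hk
        obtain ⟨φ, hφ⟩ := groth_ff F c.unop y.unop x.unop k.unop
          (congrArg Quiver.Hom.unop (hk.trans (Category.comp_id (𝟙 c))))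
        exact ⟨φ.op, congrArg Quiver.Hom.op hφ⟩
      · intro c x y φ ψ h
        exact (Grothendieck.ι F c.unop).op.map_injective h
      · intro X c f
        have hl : (F.map f.unop).toFunctor.IsLeftAdjoint := inst f.unop
        obtain ⟨x, η, h1, h2⟩ := groth_pull F X.unop c.unop f.unop hl
        refine ⟨Opposite.op x, η.op, ?_, fun Z h g hh => ?_⟩
        · exact (congrArg Quiver.Hom.op h1).trans (Category.comp_id f).symm
        · obtain ⟨k, ⟨hk1, hk2⟩, hk3⟩ := h2 Z.unop h.unop g.unop (congrArg Quiver.Hom.unop hh)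
          refine ⟨k.op, ⟨?_, congrArg Quiver.Hom.op hk2⟩, ?_⟩
          · exact (congrArg Quiver.Hom.op hk1).trans (Category.id_comp g).symm
          · rintro m ⟨hm1, hm2⟩
            exact congrArg Quiver.Hom.op (hk3 m.unop
              ⟨congrArg Quiver.Hom.unop (hm1.trans (Category.id_comp g)),
                congrArg Quiver.Hom.unop hm2⟩)
      · intro c D
        refine ⟨coconeOfConeLeftOp (limit.cone D.leftOp), fun Z g h hb hc => ?_⟩
        obtain ⟨k, ⟨hk1, hk2⟩, hk3⟩ := groth_rel_lim F c.unop D.leftOp _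
          (limit.isLimit D.leftOp) Z.unop g.unop (fun j => (h j.unop).unop)
          (fun j => congrArg Quiver.Hom.unop ((hb j.unop).trans (Category.id_comp g)))
          (fun i j a => congrArg Quiver.Hom.unop (hc _ _ a.unop))
        refine ⟨k.op, ⟨?_, fun j => congrArg Quiver.Hom.op (hk2 (Opposite.op j))⟩, ?_⟩
        · exact (congrArg Quiver.Hom.op hk1).trans (Category.id_comp g).symm
        · rintro m ⟨hm1, hm2⟩
          exact congrArg Quiver.Hom.op (hk3 m.unop
              ⟨congrArg Quiver.Hom.unop (hm1.trans (Category.id_comp g)),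
                fun j => congrArg Quiver.Hom.unop (hm2 j.unop)⟩)
    exact hasLimits_of_hasColimits_op
  · refine ⟨fun J _ => ?_⟩
    refine hasColimit_of_relative (Grothendieck.forget F)
      (Fib := fun c => F.obj c) (fun c => Grothendieck.ι F c)
      (fun c x => Iso.refl c) ?_ ?_ ?_ ?_ ?_
    · intro c x y φ
      exact (Category.comp_id (𝟙 c)).symm
    · intro c x y k hk
      exact groth_ff F c x y k (hk.trans (Category.comp_id (𝟙 c)))
    · intro c x y φ ψ h
      exact (Grothendieck.ι F c).map_injective h
    · intro X c f
      obtain ⟨x, η, h1, h2⟩ := groth_push F X c f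
      refine ⟨x, η, h1.trans (Category.comp_id f).symm, fun Z h g hh => ?_⟩
      obtain ⟨k, ⟨hk1, hk2⟩, hk3⟩ := h2 Z h g hh
      refine ⟨k, ⟨hk1.trans (Category.id_comp g).symm, hk2⟩, ?_⟩
      rintro m ⟨hm1, hm2⟩
      exact hk3 m ⟨hm1.trans (Category.id_comp g), hm2⟩
    · intro c D
      refine ⟨colimit.cocone D, fun Z g h hb hc => ?_⟩
      have : (F.map g).toFunctor.IsLeftAdjoint := inst g
      have : PreservesColimit D (F.map g).toFunctor :=
        (Adjunction.ofIsLeftAdjoint (F.map g).toFunctor).leftAdjoint_preservesColimits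
          |>.preservesColimitsOfShape.preservesColimit
      obtain ⟨k, ⟨hk1, hk2⟩, hk3⟩ := groth_rel_colim F c D _ (colimit.isColimit D) Z g this h
        (fun j => (hb j).trans (Category.id_comp g)) hc
      refine ⟨k, ⟨hk1.trans (Category.id_comp g).symm, hk2⟩, ?_⟩
      rintro m ⟨hm1, hm2⟩
      exact hk3 m ⟨hm1.trans (Category.id_comp g), hm2⟩
end

section
/- Let C be a category with all small limits and all small colimits, and let F : C ⥤ Cat be a functor such that every fiber F.obj c has all small limits and all small colimits and every transition functor F.map f is a left adjoint. Then the projection functor Grothendieck.forget F : Grothendieck F ⥤ C preserves all small limits and all small colimits. -/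
open CategoryTheory CategoryTheory.Limits

universe w v u v₂ u₂

theorem grothendieck_forget_isLeftAdjoint_aux
    {C : Type u} [Category.{v} C] (F : C ⥤ Cat.{v₂, u₂})
    (t : ∀ c : C, F.obj c) (ht : ∀ c, IsTerminal (t c)) :
    (Grothendieck.forget F).IsLeftAdjoint := by
  let e : ∀ (X : Grothendieck F) (Y : C),
      ((Grothendieck.forget F).obj X ⟶ Y) ≃ (X ⟶ (⟨Y, t Y⟩ : Grothendieck F)) := fun X Y =>
    { toFun := fun f => ⟨f, (ht Y).from _⟩
      invFun := fun g => g.base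
      left_inv := fun f => rfl
      right_inv := fun g => Grothendieck.ext _ _ rfl ((ht Y).hom_ext _ _) }
  exact (Adjunction.adjunctionOfEquivRight e
    (fun X' X Y f g => Grothendieck.ext _ _ rfl ((ht Y).hom_ext _ _))).isLeftAdjoint

theorem grothendieck_forget_isRightAdjoint_aux
    {C : Type u} [Category.{v} C] (F : C ⥤ Cat.{v₂, u₂})
    (t : ∀ c : C, F.obj c)
    (ht : ∀ (c c' : C) (f : c ⟶ c'), IsInitial ((F.map f).toFunctor.obj (t c))) :
    (Grothendieck.forget F).IsRightAdjoint := by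
  let e : ∀ (X : C) (Y : Grothendieck F),
      ((⟨X, t X⟩ : Grothendieck F) ⟶ Y) ≃ (X ⟶ (Grothendieck.forget F).obj Y) := fun X Y =>
    { toFun := fun g => g.base
      invFun := fun f => ⟨f, (ht _ _ f).to _⟩
      left_inv := fun g => Grothendieck.ext _ _ rfl ((ht _ _ _).hom_ext _ _)
      right_inv := fun f => rfl }
  exact (Adjunction.adjunctionOfEquivLeft e (fun X Y Y' f g => rfl)).isRightAdjoint

/-- Under the hypotheses of Statement 2 (a bifibration over a complete and
cocomplete base with complete and cocomplete fibers), the projection functor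
`Grothendieck.forget F : Grothendieck F ⥤ C` preserves all small limits and colimits. -/
theorem grothendieck_forget_preservesLimits_preservesColimits_of_isLeftAdjoint
    {C : Type u} [Category.{v} C] (F : C ⥤ Cat.{v₂, u₂})
    [HasLimitsOfSize.{w, w} C] [HasColimitsOfSize.{w, w} C]
    [∀ c : C, HasLimitsOfSize.{w, w} (F.obj c)]
    [∀ c : C, HasColimitsOfSize.{w, w} (F.obj c)]
    [∀ {c c' : C} (f : c ⟶ c'), (F.map f).toFunctor.IsLeftAdjoint] :
    PreservesLimitsOfSize.{w, w} (Grothendieck.forget F) ∧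
      PreservesColimitsOfSize.{w, w} (Grothendieck.forget F) := by
  have h₁ : (Grothendieck.forget F).IsLeftAdjoint := by
    have : ∀ c : C, HasTerminal (F.obj c) := fun c => by
      have := hasLimitsOfSizeShrink.{0, 0, w, w} (F.obj c)
      infer_instance
    exact grothendieck_forget_isLeftAdjoint_aux F (fun c => ⊤_ (F.obj c))
      (fun c => terminalIsTerminal)
  have h₂ : (Grothendieck.forget F).IsRightAdjoint := by
    have : ∀ c : C, HasInitial (F.obj c) := fun c => by
      have := hasColimitsOfSizeShrink.{0, 0, w, w} (F.obj c)
      infer_instance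
    refine grothendieck_forget_isRightAdjoint_aux F (fun c => ⊥_ (F.obj c)) (fun c c' f => ?_)
    have := (Adjunction.ofIsLeftAdjoint (F.map f).toFunctor).leftAdjoint_preservesColimits.{0, 0}
    exact IsInitial.isInitialObj _ _ initialIsInitial
  exact ⟨(Adjunction.ofIsRightAdjoint (Grothendieck.forget F)).rightAdjoint_preservesLimits,
    (Adjunction.ofIsLeftAdjoint (Grothendieck.forget F)).leftAdjoint_preservesColimits⟩
end

section
/- Let A be a category having all limits and all colimits indexed by small categories. Then the diagram context over A, i.e., the Grothendieck construction Grothendieck G_A, has all limits and all colimits indexed by small categories. -/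
open CategoryTheory CategoryTheory.Limits

universe w v u

/-- The diagram context over `A`: the strict functor `Catᵒᵖ ⥤ Cat` sending a small category
`B` to the functor category `B ⥤ A`, and a functor `K : B₂ ⥤ B₁` (a morphism
`op B₁ ⟶ op B₂` of `Catᵒᵖ`) to the precomposition (left-whiskering) functor
`(B₁ ⥤ A) ⥤ (B₂ ⥤ A)`. -/
@[simps]
def diagramContextFunctor (A : Type u) [Category.{v} A] :
    Cat.{w, w}ᵒᵖ ⥤ Cat.{max w v, max w v u} where
  obj B := Cat.of (B.unop ⥤ A)
  map {B₁ B₂} K := ((Functor.whiskeringLeft B₂.unop B₁.unop A).obj K.unop.toFunctor).toCatHom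

namespace DiagramContextAux

universe v₁ u₁ v₂ u₂ w₁ w₂

section Abstract

variable {E : Type u₁} [Category.{v₁} E] {K : Type u₂} [Category.{v₂} K] (I : K ⥤ E)
  {J : Type w₁} [Category.{w₂} J] (X : J ⥤ E)

theorem hasLimit_abstract [HasLimitsOfShape J K] (R : J → K) (ε : ∀ j, I.obj (R j) ⟶ X.obj j)
    (hD : ∀ {j k : J} (f : j ⟶ k), ∃ n : R j ⟶ R k, I.map n ≫ ε k = ε j ≫ X.map f)
    (hε : ∀ (y : K) (j : J) (n n' : y ⟶ R j), I.map n ≫ ε j = I.map n' ≫ ε j → n = n')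
    (hτ : ∀ s : Cone X, ∃ (y : K) (τ : s.pt ⟶ I.obj y),
      (∀ j, ∃ n : y ⟶ R j, τ ≫ I.map n ≫ ε j = s.π.app j) ∧
      (∀ j (n n' : y ⟶ R j), τ ≫ I.map n ≫ ε j = τ ≫ I.map n' ≫ ε j → n = n') ∧
      (∀ (k : K) (t : ∀ j, k ⟶ R j) (l : s.pt ⟶ I.obj k),
        (∀ j, l ≫ I.map (t j) ≫ ε j = s.π.app j) → ∃ q : y ⟶ k, τ ≫ I.map q = l)) :
    HasLimit X := by
  choose m hm using @hD
  let D : J ⥤ K :=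
    { obj := R
      map := fun f => m f
      map_id := fun j => by
        apply hε
        rw [hm]
        simp
      map_comp := fun f g => by
        apply hε
        simp [hm, reassoc_of% hm] }
  have hmD : ∀ {j k : J} (f : j ⟶ k), I.map (D.map f) ≫ ε k = ε j ≫ X.map f := hm
  let L : Cone X :=
    { pt := I.obj (limit D)
      π :=
        { app := fun j => I.map (limit.π D j) ≫ ε j
          naturality := fun j k f => by
            have h1 := hmD f
            have h2 := limit.w D f
            refine (Category.id_comp _).trans ?_
            rw [Category.assoc, ← h1, ← h2, Functor.map_comp, Category.assoc] } }
  have key : ∀ s : Cone X, ∃ l : s.pt ⟶ L.pt, (∀ j, l ≫ L.π.app j = s.π.app j) ∧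
      ∀ l' : s.pt ⟶ L.pt, (∀ j, l' ≫ L.π.app j = s.π.app j) → l' = l := by
    intro s
    obtain ⟨y, τ, h1, h2, h3⟩ := hτ s
    choose n hn using h1
    have hnat : ∀ {j k : J} (f : j ⟶ k), n j ≫ D.map f = n k := by
      intro j k f
      apply h2
      rw [hn k, ← s.w f, ← hn j, Functor.map_comp]
      simp only [Category.assoc]
      rw [hmD f]
    let t : Cone D :=
      { pt := y
        π := { app := n, naturality := fun j k f => (Category.id_comp _).trans (hnat f).symm } }
    have ht : ∀ j, limit.lift D t ≫ limit.π D j = n j := fun j => limit.lift_π t j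
    refine ⟨τ ≫ I.map (limit.lift D t), fun j => ?_, fun l' hl' => ?_⟩
    · refine (Category.assoc _ _ _).trans ?_
      rw [← hn j, ← ht j, Functor.map_comp, Category.assoc]
    · obtain ⟨q, hq⟩ := h3 (limit D) (fun j => limit.π D j) l' hl'
      rw [← hq]
      have hql : q = limit.lift D t := by
        refine limit.hom_ext fun j => ?_
        rw [ht]
        apply h2
        have h4 := hl' j
        rw [← hq] at h4
        rw [hn j, ← h4, Functor.map_comp, Category.assoc]
        exact (Category.assoc _ _ _).symm
      rw [hql]
  choose l hl hl' using key
  exact ⟨⟨⟨L, { lift := l, fac := hl, uniq := fun s m h => hl' s m h }⟩⟩⟩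

theorem hasColimit_abstract [HasColimitsOfShape J K] (P : J → K)
    (τ : ∀ j, X.obj j ⟶ I.obj (P j))
    (hD : ∀ {j k : J} (f : j ⟶ k), ∃ n : P j ⟶ P k, τ j ≫ I.map n = X.map f ≫ τ k)
    (hτ : ∀ (y : K) (j : J) (n n' : P j ⟶ y), τ j ≫ I.map n = τ j ≫ I.map n' → n = n')
    (hε : ∀ s : Cocone X, ∃ (y : K) (ε : I.obj y ⟶ s.pt),
      (∀ j, ∃ n : P j ⟶ y, τ j ≫ I.map n ≫ ε = s.ι.app j) ∧
      (∀ j (n n' : P j ⟶ y), τ j ≫ I.map n ≫ ε = τ j ≫ I.map n' ≫ ε → n = n') ∧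
      (∀ (k : K) (t : ∀ j, P j ⟶ k) (l : I.obj k ⟶ s.pt),
        (∀ j, τ j ≫ I.map (t j) ≫ l = s.ι.app j) → ∃ q : k ⟶ y, I.map q ≫ ε = l)) :
    HasColimit X := by
  choose m hm using @hD
  let D : J ⥤ K :=
    { obj := P
      map := fun f => m f
      map_id := fun j => by
        apply hτ
        rw [hm]
        simp
      map_comp := fun f g => by
        apply hτ
        simp [hm, reassoc_of% hm] }
  have hmD : ∀ {j k : J} (f : j ⟶ k), τ j ≫ I.map (D.map f) = X.map f ≫ τ k := hm
  let L : Cocone X :=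
    { pt := I.obj (colimit D)
      ι :=
        { app := fun j => τ j ≫ I.map (colimit.ι D j)
          naturality := fun j k f => by
            have h1 := hmD f
            have h2 := colimit.w D f
            refine Eq.trans ?_ (Category.comp_id _).symm
            rw [← Category.assoc, ← h1, ← h2, Functor.map_comp, Category.assoc] } }
  have key : ∀ s : Cocone X, ∃ l : L.pt ⟶ s.pt, (∀ j, L.ι.app j ≫ l = s.ι.app j) ∧
      ∀ l' : L.pt ⟶ s.pt, (∀ j, L.ι.app j ≫ l' = s.ι.app j) → l' = l := by
    intro s
    obtain ⟨y, ε, h1, h2, h3⟩ := hε s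
    choose n hn using h1
    have hnat : ∀ {j k : J} (f : j ⟶ k), D.map f ≫ n k = n j := by
      intro j k f
      apply h2
      rw [hn j, ← s.w f, ← hn k, Functor.map_comp]
      have h4 := hmD f
      rw [← Category.assoc (X.map f), ← h4]
      simp only [Category.assoc]
    let t : Cocone D :=
      { pt := y
        ι := { app := n, naturality := fun j k f => (hnat f).trans (Category.comp_id _).symm } }
    have ht : ∀ j, colimit.ι D j ≫ colimit.desc D t = n j := fun j => colimit.ι_desc t j
    refine ⟨I.map (colimit.desc D t) ≫ ε, fun j => ?_, fun l' hl' => ?_⟩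
    · refine (Category.assoc _ _ _).trans ?_
      rw [← hn j, ← ht j, Functor.map_comp, Category.assoc]
    · obtain ⟨q, hq⟩ := h3 (colimit D) (fun j => colimit.ι D j) l' (fun j =>
        (Category.assoc _ _ _).symm.trans (hl' j))
      rw [← hq]
      have hql : q = colimit.desc D t := by
        refine colimit.hom_ext fun j => ?_
        rw [ht]
        apply h2
        have h4 := hl' j
        rw [← hq] at h4
        rw [hn j, ← h4, Functor.map_comp, Category.assoc]
        exact (Category.assoc _ _ _).symm
      rw [hql]
  choose l hl hl' using key
  exact ⟨⟨⟨L, { desc := l, fac := hl, uniq := fun s m h => hl' s m h }⟩⟩⟩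

end Abstract

section General

variable {C : Type u₁} [Category.{v₁} C] {F : C ⥤ Cat.{v₂, u₂}}

/-- Explicit morphisms of the Grothendieck construction. -/
def H {c d : C} {x : F.obj c} {y : F.obj d} (u : c ⟶ d)
    (φ : (F.map u).toFunctor.obj x ⟶ y) : (⟨c, x⟩ : Grothendieck F) ⟶ ⟨d, y⟩ := ⟨u, φ⟩

theorem exists_H {c d : C} {x : F.obj c} {y : F.obj d} (g : (⟨c, x⟩ : Grothendieck F) ⟶ ⟨d, y⟩)
    (u : c ⟶ d) (h : g.base = u) : ∃ φ, g = H u φ := by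
  subst h
  exact ⟨g.fiber, rfl⟩

theorem H_inj {c d : C} {x : F.obj c} {y : F.obj d} (u : c ⟶ d)
    (φ ψ : (F.map u).toFunctor.obj x ⟶ y) (h : H u φ = H u ψ) : φ = ψ := by
  unfold H at h
  injection h

theorem H_congr {c d : C} {x : F.obj c} {y : F.obj d} {u v : c ⟶ d} (h : u = v)
    (φ : (F.map u).toFunctor.obj x ⟶ y) :
    H u φ = H v (eqToHom (by rw [h]) ≫ φ) := by
  subst h
  simp

theorem H_comp {c d e : C} {x : F.obj c} {y : F.obj d} {z : F.obj e} (u : c ⟶ d) (v : d ⟶ e)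
    (φ : (F.map u).toFunctor.obj x ⟶ y) (ψ : (F.map v).toFunctor.obj y ⟶ z) :
    H u φ ≫ H v ψ = H (u ≫ v) (eqToHom (by simp) ≫ (F.map v).toFunctor.map φ ≫ ψ) := rfl

/-- The inclusion of the fibre, on morphisms. -/
theorem ι_map {c : C} {y y' : F.obj c} (n : y ⟶ y') :
    (Grothendieck.ι F c).map n = H (𝟙 c) (eqToHom (by simp) ≫ n) := rfl

theorem τ_comp {c d e : C} {x : F.obj c} {z : F.obj e} (u : c ⟶ d) (v : d ⟶ e)
    (ψ : (F.map v).toFunctor.obj ((F.map u).toFunctor.obj x) ⟶ z) :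
    H u (𝟙 ((F.map u).toFunctor.obj x)) ≫ H v ψ = H (u ≫ v) (eqToHom (by simp) ≫ ψ) := by
  rw [H_comp]
  simp

theorem τ_ι {c d : C} {x : F.obj c} {z : F.obj d} (u : c ⟶ d)
    (n : (F.map u).toFunctor.obj x ⟶ z) :
    H u (𝟙 ((F.map u).toFunctor.obj x)) ≫ (Grothendieck.ι F d).map n = H u n := by
  refine (τ_comp u (𝟙 d) _).trans ?_
  rw [H_congr (Category.comp_id u)]
  simp

theorem ι_comp {c d : C} {y y' : F.obj c} {z : F.obj d} (n : y ⟶ y')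
    (v : c ⟶ d) (φ : (F.map v).toFunctor.obj y' ⟶ z) :
    (Grothendieck.ι F c).map n ≫ H v φ = H v ((F.map v).toFunctor.map n ≫ φ) := by
  refine (H_comp (𝟙 c) v _ φ).trans ?_
  rw [H_congr (Category.id_comp v)]
  simp [eqToHom_map]

theorem τ_uniq {c d e : C} {x : F.obj c} {z : F.obj e} (u : c ⟶ d) (v : d ⟶ e)
    (φ ψ : (F.map v).toFunctor.obj ((F.map u).toFunctor.obj x) ⟶ z)
    (h : H u (𝟙 ((F.map u).toFunctor.obj x)) ≫ H v φ =
      H u (𝟙 ((F.map u).toFunctor.obj x)) ≫ H v ψ) : φ = ψ := by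
  rw [τ_comp, τ_comp] at h
  have h2 := H_inj _ _ _ h
  exact (cancel_epi _).1 h2

theorem τ_exists {c d e : C} {x : F.obj c} {z : F.obj e} (u : c ⟶ d) (v : d ⟶ e)
    (φ : (F.map (u ≫ v)).toFunctor.obj x ⟶ z) :
    ∃ ψ, H u (𝟙 ((F.map u).toFunctor.obj x)) ≫ H v ψ = H (u ≫ v) φ := by
  refine ⟨eqToHom (by simp) ≫ φ, ?_⟩
  rw [τ_comp]
  simp

variable [∀ {c d : C} (t : c ⟶ d), (F.map t).toFunctor.IsLeftAdjoint]

/-- The counit. -/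
noncomputable def cou {c d : C} (v : c ⟶ d) (z : F.obj d) :
    (F.map v).toFunctor.obj ((F.map v).toFunctor.rightAdjoint.obj z) ⟶ z :=
  (Adjunction.ofIsLeftAdjoint (F.map v).toFunctor).counit.app z

theorem cou_exists {c d : C} (v : c ⟶ d) (z : F.obj d) {y : F.obj c}
    (φ : (F.map v).toFunctor.obj y ⟶ z) :
    ∃ n : y ⟶ (F.map v).toFunctor.rightAdjoint.obj z,
      (F.map v).toFunctor.map n ≫ cou v z = φ :=
  ⟨(Adjunction.ofIsLeftAdjoint (F.map v).toFunctor).homEquiv _ _ φ,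
    ((Adjunction.ofIsLeftAdjoint (F.map v).toFunctor).homEquiv_counit _ _ _).symm.trans
      (Equiv.symm_apply_apply _ _)⟩

theorem cou_uniq {c d : C} (v : c ⟶ d) (z : F.obj d) {y : F.obj c}
    (n n' : y ⟶ (F.map v).toFunctor.rightAdjoint.obj z)
    (h : (F.map v).toFunctor.map n ≫ cou v z = (F.map v).toFunctor.map n' ≫ cou v z) :
    n = n' :=
  ((Adjunction.ofIsLeftAdjoint (F.map v).toFunctor).homEquiv _ _).symm.injective
    (((Adjunction.ofIsLeftAdjoint (F.map v).toFunctor).homEquiv_counit _ _ _).trans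
      (h.trans ((Adjunction.ofIsLeftAdjoint (F.map v).toFunctor).homEquiv_counit _ _ _).symm))

/-- The cocartesian lift. -/
def τ (Y : Grothendieck F) {c : C} (u : Y.base ⟶ c) :
    Y ⟶ (Grothendieck.ι F c).obj ((F.map u).toFunctor.obj Y.fiber) :=
  H u (𝟙 ((F.map u).toFunctor.obj Y.fiber))

/-- The cartesian lift. -/
noncomputable def ε (Z : Grothendieck F) {c : C} (v : c ⟶ Z.base) :
    (Grothendieck.ι F c).obj ((F.map v).toFunctor.rightAdjoint.obj Z.fiber) ⟶ Z :=
  H v (cou v Z.fiber)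

theorem cart (Z : Grothendieck F) {c : C} (v : c ⟶ Z.base) {y : F.obj c}
    (g : (Grothendieck.ι F c).obj y ⟶ Z) (h : g.base = v) :
    ∃ n, (Grothendieck.ι F c).map n ≫ ε Z v = g := by
  obtain ⟨φ, rfl⟩ := exists_H (x := y) (y := Z.fiber) g v h
  obtain ⟨n, rfl⟩ := cou_exists v Z.fiber φ
  exact ⟨n, ι_comp n v _⟩

theorem cart_uniq (Z : Grothendieck F) {c : C} (v : c ⟶ Z.base) {y : F.obj c}
    (n n' : y ⟶ (F.map v).toFunctor.rightAdjoint.obj Z.fiber)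
    (h : (Grothendieck.ι F c).map n ≫ ε Z v = (Grothendieck.ι F c).map n' ≫ ε Z v) : n = n' := by
  refine cou_uniq v _ _ _ (H_inj v _ _ ?_)
  exact (ι_comp n v _).symm.trans (h.trans (ι_comp n' v _))

theorem push (Y : Grothendieck F) {c : C} (u : Y.base ⟶ c) {y : F.obj c}
    (g : Y ⟶ (Grothendieck.ι F c).obj y) (h : g.base = u) :
    ∃ n, τ Y u ≫ (Grothendieck.ι F c).map n = g := by
  obtain ⟨φ, rfl⟩ := exists_H (x := Y.fiber) (y := y) g u h
  exact ⟨φ, τ_ι u φ⟩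

theorem push_uniq (Y : Grothendieck F) {c : C} (u : Y.base ⟶ c) {y : F.obj c}
    (n n' : (F.map u).toFunctor.obj Y.fiber ⟶ y)
    (h : τ Y u ≫ (Grothendieck.ι F c).map n = τ Y u ≫ (Grothendieck.ι F c).map n') : n = n' :=
  H_inj u _ _ ((τ_ι u n).symm.trans (h.trans (τ_ι u n')))

theorem both (Y Z : Grothendieck F) {c : C} (u : Y.base ⟶ c) (v : c ⟶ Z.base)
    (g : Y ⟶ Z) (h : g.base = u ≫ v) :
    ∃ n, τ Y u ≫ (Grothendieck.ι F c).map n ≫ ε Z v = g := by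
  obtain ⟨φ, rfl⟩ := exists_H (x := Y.fiber) (y := Z.fiber) g (u ≫ v) h
  obtain ⟨ψ, hψ⟩ := τ_exists u v φ
  obtain ⟨n, hn⟩ := cart Z v (y := (F.map u).toFunctor.obj Y.fiber) (H v ψ) rfl
  exact ⟨n, (congrArg (fun t => τ Y u ≫ t) hn).trans hψ⟩

theorem both_uniq (Y Z : Grothendieck F) {c : C} (u : Y.base ⟶ c) (v : c ⟶ Z.base)
    (n n' : (F.map u).toFunctor.obj Y.fiber ⟶ (F.map v).toFunctor.rightAdjoint.obj Z.fiber)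
    (h : τ Y u ≫ (Grothendieck.ι F c).map n ≫ ε Z v =
      τ Y u ≫ (Grothendieck.ι F c).map n' ≫ ε Z v) : n = n' := by
  refine cou_uniq v _ _ _ (τ_uniq u v _ _ ?_)
  exact (congrArg (fun t => τ Y u ≫ t) (ι_comp n v (cou v Z.fiber))).symm.trans
    (h.trans (congrArg (fun t => τ Y u ≫ t) (ι_comp n' v (cou v Z.fiber))))

theorem ι_ε_base (Z : Grothendieck F) {c : C} (v : c ⟶ Z.base) {y : F.obj c}
    (n : y ⟶ (F.map v).toFunctor.rightAdjoint.obj Z.fiber) :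
    ((Grothendieck.ι F c).map n ≫ ε Z v).base = v := Category.id_comp v

theorem τ_ι_base (Y : Grothendieck F) {c : C} (u : Y.base ⟶ c) {y : F.obj c}
    (n : (F.map u).toFunctor.obj Y.fiber ⟶ y) :
    (τ Y u ≫ (Grothendieck.ι F c).map n).base = u := Category.comp_id u

theorem hasLimit {J : Type w₁} [Category.{w₂} J] (X : J ⥤ Grothendieck F)
    [HasLimit (X ⋙ Grothendieck.forget F)] [∀ c, HasLimitsOfShape J (F.obj c)] :
    HasLimit X := by
  let π : ∀ j, limit (X ⋙ Grothendieck.forget F) ⟶ (X.obj j).base :=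
    fun j => limit.π (X ⋙ Grothendieck.forget F) j
  refine hasLimit_abstract (Grothendieck.ι F (limit (X ⋙ Grothendieck.forget F))) X
    (fun j => (F.map (π j)).toFunctor.rightAdjoint.obj (X.obj j).fiber)
    (fun j => ε (X.obj j) (π j)) (fun {j k} f => ?_) (fun y j n n' h => ?_) (fun s => ?_)
  · exact cart _ _ _ (limit.w (X ⋙ Grothendieck.forget F) f)
  · exact cart_uniq _ _ _ _ h
  · let u : s.pt.base ⟶ limit (X ⋙ Grothendieck.forget F) :=
      limit.lift _ ((Grothendieck.forget F).mapCone s)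
    have hu : ∀ j, (s.π.app j).base = u ≫ π j := fun j =>
      (limit.lift_π ((Grothendieck.forget F).mapCone s) j).symm
    refine ⟨_, τ s.pt u, fun j => both _ _ _ _ _ (hu j),
      fun j n n' h => both_uniq _ _ _ _ _ _ h, fun k t l hl => push _ _ _ ?_⟩
    refine limit.hom_ext (F := X ⋙ Grothendieck.forget F) fun j => ?_
    refine Eq.trans ?_ (hu j)
    refine Eq.trans ?_ (congrArg Grothendieck.Hom.base (hl j))
    exact (congrArg (fun z => l.base ≫ z) (ι_ε_base (X.obj j) (π j) (t j))).symm

theorem hasColimit {J : Type w₁} [Category.{w₂} J] (X : J ⥤ Grothendieck F)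
    [HasColimit (X ⋙ Grothendieck.forget F)] [∀ c, HasColimitsOfShape J (F.obj c)] :
    HasColimit X := by
  let i : ∀ j, (X.obj j).base ⟶ colimit (X ⋙ Grothendieck.forget F) :=
    fun j => colimit.ι (X ⋙ Grothendieck.forget F) j
  refine hasColimit_abstract (Grothendieck.ι F (colimit (X ⋙ Grothendieck.forget F))) X
    (fun j => (F.map (i j)).toFunctor.obj (X.obj j).fiber)
    (fun j => τ (X.obj j) (i j)) (fun {j k} f => ?_) (fun y j n n' h => ?_) (fun s => ?_)
  · exact push _ _ _ (colimit.w (X ⋙ Grothendieck.forget F) f)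
  · exact push_uniq _ _ _ _ h
  · let u : colimit (X ⋙ Grothendieck.forget F) ⟶ s.pt.base :=
      colimit.desc _ ((Grothendieck.forget F).mapCocone s)
    have hu : ∀ j, (s.ι.app j).base = i j ≫ u := fun j =>
      (colimit.ι_desc ((Grothendieck.forget F).mapCocone s) j).symm
    refine ⟨_, ε s.pt u, fun j => both _ _ _ _ _ (hu j),
      fun j n n' h => both_uniq _ _ _ _ _ _ h, fun k t l hl => cart _ _ _ ?_⟩
    refine colimit.hom_ext (F := X ⋙ Grothendieck.forget F) fun j => ?_
    refine Eq.trans ?_ (hu j)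
    refine Eq.trans ?_ (congrArg Grothendieck.Hom.base
      ((Category.assoc _ _ _).trans (hl j)))
    exact (congrArg (fun z => z ≫ l.base) (τ_ι_base (X.obj j) (i j) (t j))).symm

end General

end DiagramContextAux

/-- If `A` has all limits and colimits indexed by small categories, then the
diagram context over `A`, i.e. the Grothendieck construction of `diagramContextFunctor A`,
has all limits and all colimits indexed by small categories. -/
theorem diagramContext_hasLimits_hasColimits (A : Type u) [Category.{v} A]
    [HasLimitsOfSize.{w, w} A] [HasColimitsOfSize.{w, w} A] :
    HasLimitsOfSize.{w, w} (Grothendieck (diagramContextFunctor.{w} A)) ∧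
      HasColimitsOfSize.{w, w} (Grothendieck (diagramContextFunctor.{w} A)) := by
  have hadj : ∀ {c d : Cat.{w, w}ᵒᵖ} (t : c ⟶ d),
      ((diagramContextFunctor.{w} A).map t).toFunctor.IsLeftAdjoint := fun t =>
    (t.unop.toFunctor.ranAdjunction A).isLeftAdjoint
  have hL : ∀ c, HasLimitsOfSize.{w, w} ((diagramContextFunctor.{w} A).obj c) := fun c =>
    inferInstanceAs (HasLimitsOfSize.{w, w} (c.unop ⥤ A))
  have hC : ∀ c, HasColimitsOfSize.{w, w} ((diagramContextFunctor.{w} A).obj c) := fun c =>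
    inferInstanceAs (HasColimitsOfSize.{w, w} (c.unop ⥤ A))
  exact ⟨⟨fun J _ => ⟨fun X => DiagramContextAux.hasLimit X⟩⟩,
    ⟨fun J _ => ⟨fun X => DiagramContextAux.hasColimit X⟩⟩⟩
end

section
/- Let A be a category having all limits and all colimits indexed by small categories. Then the projection functor Grothendieck.forget G_A : Grothendieck G_A ⥤ Catᵒᵖ from the diagram context over A, sending (B, D) to B, preserves all limits and all colimits indexed by small categories. -/
open CategoryTheory CategoryTheory.Limits

universe w v u

/-- If every fiber has a terminal object, the projection is a left adjoint. -/
lemma grothendieck_forget_isLeftAdjoint {C : Type*} [Category C] (F : C ⥤ Cat)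
    (t : ∀ c, F.obj c) (ht : ∀ c, IsTerminal (t c)) :
    (Grothendieck.forget F).IsLeftAdjoint := by
  let e : ∀ (X : Grothendieck F) (Y : C),
      ((Grothendieck.forget F).obj X ⟶ Y) ≃ (X ⟶ (⟨Y, t Y⟩ : Grothendieck F)) := fun X Y =>
    { toFun := fun f => ⟨f, (ht Y).from _⟩
      invFun := fun g => g.base
      left_inv := fun f => rfl
      right_inv := fun g => Grothendieck.ext _ _ rfl ((ht Y).hom_ext _ _) }
  exact (Adjunction.adjunctionOfEquivRight e (fun X' X Y f g =>
    Grothendieck.ext _ _ rfl ((ht Y).hom_ext _ _))).isLeftAdjoint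

/-- If every fiber has an initial object and these are preserved by the transition functors,
the projection is a right adjoint. -/
lemma grothendieck_forget_isRightAdjoint {C : Type*} [Category C] (F : C ⥤ Cat)
    (t : ∀ c, F.obj c)
    (ht : ∀ {c d} (f : c ⟶ d), IsInitial ((F.map f).toFunctor.obj (t c))) :
    (Grothendieck.forget F).IsRightAdjoint := by
  let e : ∀ (X : C) (Y : Grothendieck F),
      ((⟨X, t X⟩ : Grothendieck F) ⟶ Y) ≃ (X ⟶ (Grothendieck.forget F).obj Y) := fun X Y =>
    { toFun := fun g => g.base
      invFun := fun f => ⟨f, (ht f).to _⟩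
      left_inv := fun g => Grothendieck.ext _ _ rfl ((ht _).hom_ext _ _)
      right_inv := fun f => rfl }
  exact (Adjunction.adjunctionOfEquivLeft e (fun X Y Y' f g => rfl)).isRightAdjoint

/-- The constant functor at a terminal object is terminal. -/
def constIsTerminal (B : Type*) [Category B] {A : Type*} [Category A] {a : A}
    (ha : IsTerminal a) : IsTerminal ((Functor.const B).obj a) :=
  IsTerminal.ofUniqueHom (fun D => { app := fun _ => ha.from _, naturality := fun _ _ _ => ha.hom_ext _ _ })
    (fun _ _ => by ext; exact ha.hom_ext _ _)

/-- The constant functor at an initial object is initial. -/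
def constIsInitial (B : Type*) [Category B] {A : Type*} [Category A] {a : A}
    (ha : IsInitial a) : IsInitial ((Functor.const B).obj a) :=
  IsInitial.ofUniqueHom (fun D => { app := fun _ => ha.to _, naturality := fun _ _ _ => ha.hom_ext _ _ })
    (fun _ _ => by ext; exact ha.hom_ext _ _)

/-- If `A` has all limits and colimits indexed by small categories, then the
projection functor `Grothendieck.forget` from the diagram context over `A` to `Catᵒᵖ`,
sending `(B, D)` to `B`, preserves all limits and all colimits indexed by small categories. -/
theorem diagramContext_forget_preservesLimits_preservesColimits (A : Type u) [Category.{v} A]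
    [HasLimitsOfSize.{w, w} A] [HasColimitsOfSize.{w, w} A] :
    PreservesLimitsOfSize.{w, w} (Grothendieck.forget (diagramContextFunctor.{w} A)) ∧
      PreservesColimitsOfSize.{w, w} (Grothendieck.forget (diagramContextFunctor.{w} A)) := by
  have : HasLimitsOfSize.{0, 0} A := hasLimitsOfSizeShrink.{0, 0, w, w} A
  have : HasColimitsOfSize.{0, 0} A := hasColimitsOfSizeShrink.{0, 0, w, w} A
  have h1 : (Grothendieck.forget (diagramContextFunctor.{w} A)).IsRightAdjoint :=
    grothendieck_forget_isRightAdjoint _ (fun B => (Functor.const B.unop).obj (⊥_ A))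
      (fun {c d} f => constIsInitial d.unop initialIsInitial)
  have h2 : (Grothendieck.forget (diagramContextFunctor.{w} A)).IsLeftAdjoint :=
    grothendieck_forget_isLeftAdjoint _ (fun B => (Functor.const B.unop).obj (⊤_ A))
      (fun c => constIsTerminal c.unop terminalIsTerminal)
  exact ⟨(Adjunction.ofIsRightAdjoint _).rightAdjoint_preservesLimits,
    (Adjunction.ofIsLeftAdjoint _).leftAdjoint_preservesColimits⟩
end

section
/- The context of schemas, i.e., the diagram context over the arrow category Arrow (Type u) (the category of signatures: objects are functions s : I → X between types, morphisms are commuting squares), has all limits and all colimits indexed by small categories, and its projection functor to Catᵒᵖ, sending (B, D) to B, preserves all such limits and colimits. -/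
open CategoryTheory CategoryTheory.Limits

universe w v u

namespace SchemaAux

universe v₁ u₁ v₂ u₂ w₁

section General

variable {C : Type u₁} [Category.{v₁} C] {F : C ⥤ Cat.{v₂, u₂}}

/-- Build a morphism of the Grothendieck construction. -/
def gm {X Y : Grothendieck F} (h : X.base ⟶ Y.base)
    (φ : (F.map h).toFunctor.obj X.fiber ⟶ Y.fiber) : X ⟶ Y := ⟨h, φ⟩

@[simp] lemma gm_base {X Y : Grothendieck F} (h : X.base ⟶ Y.base)
    (φ : (F.map h).toFunctor.obj X.fiber ⟶ Y.fiber) : (gm h φ).base = h := rfl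

@[simp] lemma gm_fiber {X Y : Grothendieck F} (h : X.base ⟶ Y.base)
    (φ : (F.map h).toFunctor.obj X.fiber ⟶ Y.fiber) : (gm h φ).fiber = φ := rfl

lemma gm_inj {X Y : Grothendieck F} {h : X.base ⟶ Y.base}
    {φ ψ : (F.map h).toFunctor.obj X.fiber ⟶ Y.fiber} (e : gm h φ = gm h ψ) : φ = ψ := by
  exact eq_of_heq (Grothendieck.Hom.mk.inj e).2

lemma exists_gm {X Y : Grothendieck F} (g : X ⟶ Y) {h : X.base ⟶ Y.base} (e : g.base = h) :
    ∃ φ, g = gm h φ := by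
  subst e
  exact ⟨g.fiber, rfl⟩

lemma exists_gm₂ {X Y : Grothendieck F} (g g' : X ⟶ Y) (e : g.base = g'.base) :
    ∃ h φ φ', g = gm h φ ∧ g' = gm h φ' := by
  obtain ⟨φ, hφ⟩ := exists_gm g e
  exact ⟨g'.base, φ, g'.fiber, hφ, rfl⟩

/-- Build a morphism between explicit pairs. -/
def gp {c d : C} {x : F.obj c} {y : F.obj d} (h : c ⟶ d)
    (φ : (F.map h).toFunctor.obj x ⟶ y) : (⟨c, x⟩ : Grothendieck F) ⟶ ⟨d, y⟩ := ⟨h, φ⟩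

lemma gp_comp {c d e : C} {x : F.obj c} {y : F.obj d} {z : F.obj e} (h : c ⟶ d)
    (φ : (F.map h).toFunctor.obj x ⟶ y) (k : d ⟶ e) (ψ : (F.map k).toFunctor.obj y ⟶ z) :
    gp h φ ≫ gp k ψ = gp (h ≫ k) (eqToHom (by simp) ≫ (F.map k).toFunctor.map φ ≫ ψ) := rfl

lemma gp_ext {c d : C} {x : F.obj c} {y : F.obj d} {h h' : c ⟶ d}
    (φ : (F.map h).toFunctor.obj x ⟶ y) (φ' : (F.map h').toFunctor.obj x ⟶ y) (e : h = h')
    (e' : φ = eqToHom (by rw [e]) ≫ φ') : gp h φ = gp h' φ' := by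
  subst e
  rw [e']
  simp

lemma gp_inj {c d : C} {x : F.obj c} {y : F.obj d} {h : c ⟶ d}
    {φ φ' : (F.map h).toFunctor.obj x ⟶ y} (e : gp h φ = gp h φ') : φ = φ' :=
  eq_of_heq (Grothendieck.Hom.mk.inj e).2

/-- Vertical morphisms. -/
def vert {c : C} {x y : F.obj c} (a : x ⟶ y) : (⟨c, x⟩ : Grothendieck F) ⟶ ⟨c, y⟩ :=
  gp (𝟙 c) (eqToHom (by simp) ≫ a)

@[simp] lemma vert_base {c : C} {x y : F.obj c} (a : x ⟶ y) :
    (vert a : (⟨c, x⟩ : Grothendieck F) ⟶ ⟨c, y⟩).base = 𝟙 c := rfl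

lemma exists_vert {c : C} {x y : F.obj c} (g : (⟨c, x⟩ : Grothendieck F) ⟶ ⟨c, y⟩)
    (e : g.base = 𝟙 c) : ∃ a : x ⟶ y, g = vert a := by
  obtain ⟨φ, rfl⟩ : ∃ φ, g = gp (𝟙 c) φ := exists_gm g e
  refine ⟨eqToHom (by simp) ≫ φ, ?_⟩
  refine gp_ext _ _ rfl ?_
  simp

lemma vert_comp {c : C} {x y z : F.obj c} (a : x ⟶ y) (b : y ⟶ z) :
    (vert a : (⟨c, x⟩ : Grothendieck F) ⟶ ⟨c, y⟩) ≫ vert b = vert (a ≫ b) :=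
  ((Grothendieck.ι F c).map_comp a b).symm

lemma map_id_map {c : C} {x y : F.obj c} (φ : x ⟶ y) :
    (F.map (𝟙 c)).toFunctor.map φ = eqToHom (by simp) ≫ φ ≫ eqToHom (by simp) := by
  have key : ∀ (G : F.obj c ⥤ F.obj c) (hG : G = 𝟭 _),
      G.map φ = eqToHom (by rw [hG]; rfl) ≫ φ ≫ eqToHom (by rw [hG]; rfl) := by
    rintro _ rfl
    simp
  exact key _ (by rw [F.map_id]; rfl)

lemma gp_vert {d c : C} {x : F.obj d} {y z : F.obj c} (h : d ⟶ c)
    (φ : (F.map h).toFunctor.obj x ⟶ y) (a : y ⟶ z) :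
    gp h φ ≫ vert a = gp h (φ ≫ a) := by
  refine (gp_comp _ _ _ _).trans (gp_ext _ _ (Category.comp_id _) ?_)
  rw [map_id_map]
  simp

lemma gm_vert {X : Grothendieck F} {c : C} {y z : F.obj c} (h : X.base ⟶ c)
    (φ : (F.map h).toFunctor.obj X.fiber ⟶ y) (a : y ⟶ z) :
    (gm (Y := ⟨c, y⟩) h φ) ≫ vert a = gm (Y := ⟨c, z⟩) h (φ ≫ a) :=
  gp_vert h φ a

lemma vert_gp {c d : C} {x y : F.obj c} {z : F.obj d} (h : c ⟶ d)
    (φ : (F.map h).toFunctor.obj y ⟶ z) (a : x ⟶ y) :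
    vert a ≫ gp h φ = gp h ((F.map h).toFunctor.map a ≫ φ) := by
  refine (gp_comp _ _ _ _).trans (gp_ext _ _ (Category.id_comp _) ?_)
  simp [eqToHom_map]

lemma vert_gm {Z : Grothendieck F} {c : C} {x y : F.obj c} (h : c ⟶ Z.base)
    (φ : (F.map h).toFunctor.obj y ⟶ Z.fiber) (a : x ⟶ y) :
    vert a ≫ (gm (X := ⟨c, y⟩) h φ) =
      gm (X := ⟨c, x⟩) h ((F.map h).toFunctor.map a ≫ φ) :=
  vert_gp h φ a

/-! ### cocartesian and cartesian lifts -/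

/-- cocartesian lift -/
def cocart (X : Grothendieck F) {c : C} (k : X.base ⟶ c) :
    X ⟶ ⟨c, (F.map k).toFunctor.obj X.fiber⟩ :=
  gm k (𝟙 _)

@[simp] lemma cocart_base (X : Grothendieck F) {c : C} (k : X.base ⟶ c) :
    (cocart X k).base = k := rfl

lemma cocart_gm (X : Grothendieck F) {c : C} (k : X.base ⟶ c) {Z : Grothendieck F}
    (h : c ⟶ Z.base)
    (φ : (F.map h).toFunctor.obj ((F.map k).toFunctor.obj X.fiber) ⟶ Z.fiber) :
    cocart X k ≫ gm (X := ⟨c, _⟩) h φ = gm (k ≫ h) (eqToHom (by simp) ≫ φ) := by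
  refine (gp_comp k (𝟙 _) h φ).trans (gp_ext _ _ rfl ?_)
  simp

lemma cocart_exists (X : Grothendieck F) {c : C} (k : X.base ⟶ c) {Z : Grothendieck F}
    (h : c ⟶ Z.base) (g : X ⟶ Z) (e : g.base = k ≫ h) :
    ∃ g' : (⟨c, (F.map k).toFunctor.obj X.fiber⟩ : Grothendieck F) ⟶ Z,
      g'.base = h ∧ cocart X k ≫ g' = g := by
  obtain ⟨φ, rfl⟩ := exists_gm g e
  refine ⟨gm (X := ⟨c, _⟩) h (eqToHom (by simp) ≫ φ), rfl, ?_⟩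
  rw [cocart_gm]
  simp

lemma cocart_unique (X : Grothendieck F) {c : C} (k : X.base ⟶ c) {Z : Grothendieck F}
    (g g' : (⟨c, (F.map k).toFunctor.obj X.fiber⟩ : Grothendieck F) ⟶ Z)
    (e : g.base = g'.base) (e' : cocart X k ≫ g = cocart X k ≫ g') : g = g' := by
  obtain ⟨h, φ, φ', rfl, rfl⟩ := exists_gm₂ g g' e
  have := gm_inj ((cocart_gm X k h φ).symm.trans (e'.trans (cocart_gm X k h φ')))
  rw [cancel_epi] at this
  rw [this]

variable [∀ {c d : C} (k : c ⟶ d), (F.map k).toFunctor.IsLeftAdjoint]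

lemma cart_exists (Y : Grothendieck F) {c : C} (k : c ⟶ Y.base) :
    ∃ (y' : F.obj c) (φ : (⟨c, y'⟩ : Grothendieck F) ⟶ Y), φ.base = k ∧
      (∀ (Z : Grothendieck F) (h : Z.base ⟶ c) (g : Z ⟶ Y), g.base = h ≫ k →
        ∃ g' : Z ⟶ ⟨c, y'⟩, g'.base = h ∧ g' ≫ φ = g) ∧
      (∀ (Z : Grothendieck F) (g g' : Z ⟶ ⟨c, y'⟩), g.base = g'.base →
        g ≫ φ = g' ≫ φ → g = g') := by
  let adj := Adjunction.ofIsLeftAdjoint (F.map k).toFunctor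
  let R := (F.map k).toFunctor.rightAdjoint
  have comp : ∀ (Z : Grothendieck F) (h : Z.base ⟶ c)
      (ψ : (F.map h).toFunctor.obj Z.fiber ⟶ R.obj Y.fiber),
      gm (Y := ⟨c, R.obj Y.fiber⟩) h ψ ≫ gm (X := ⟨c, R.obj Y.fiber⟩) k (adj.counit.app Y.fiber) =
        gm (h ≫ k) (eqToHom (by simp) ≫ (adj.homEquiv _ _).symm ψ) := by
    intro Z h ψ
    refine (gp_comp h ψ k (adj.counit.app Y.fiber)).trans (gp_ext _ _ rfl ?_)
    simp [Adjunction.homEquiv_counit]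
  refine ⟨R.obj Y.fiber, gm (X := ⟨c, R.obj Y.fiber⟩) k (adj.counit.app Y.fiber), rfl, ?_, ?_⟩
  · intro Z h g e
    obtain ⟨φ, rfl⟩ := exists_gm g e
    refine ⟨gm (Y := ⟨c, R.obj Y.fiber⟩) h (adj.homEquiv _ _ (eqToHom (by simp) ≫ φ)), rfl, ?_⟩
    rw [comp]
    simp
  · intro Z g g' e e'
    obtain ⟨h, φ, φ', rfl, rfl⟩ := exists_gm₂ g g' e
    have := (comp Z _ φ).symm.trans (e'.trans (comp Z _ φ'))
    have := gm_inj this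
    rw [cancel_epi] at this
    rw [(adj.homEquiv _ _).symm.injective this]

/-! ### relative products and equalizers in the fibres -/

lemma relprod (c : C) [HasProducts.{w₁} (F.obj c)] (J : Type w₁) (y : J → F.obj c) :
    ∃ (w : F.obj c) (p : ∀ j, (⟨c, w⟩ : Grothendieck F) ⟶ ⟨c, y j⟩),
      (∀ j, (p j).base = 𝟙 c) ∧
      (∀ (Z : Grothendieck F) (h : Z.base ⟶ c) (g : ∀ j, Z ⟶ ⟨c, y j⟩), (∀ j, (g j).base = h) →
        ∃ g' : Z ⟶ ⟨c, w⟩, g'.base = h ∧ ∀ j, g' ≫ p j = g j) ∧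
      (∀ (Z : Grothendieck F) (g g' : Z ⟶ ⟨c, w⟩), g.base = g'.base →
        (∀ j, g ≫ p j = g' ≫ p j) → g = g') := by
  refine ⟨∏ᶜ y, fun j => vert (Pi.π y j), fun _ => rfl, ?_, ?_⟩
  · intro Z h g e
    choose φ hφ using fun j => exists_gm (g j) (e j)
    refine ⟨gm (Y := ⟨c, ∏ᶜ y⟩) h (Pi.lift φ), rfl, fun j => ?_⟩
    rw [gm_vert, hφ j]
    simp
  · intro Z g g' e e'
    obtain ⟨h, φ, φ', rfl, rfl⟩ := exists_gm₂ g g' e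
    congr 1
    refine Pi.hom_ext _ _ fun j => ?_
    have := (gm_vert _ φ (Pi.π y j)).symm.trans ((e' j).trans (gm_vert _ φ' (Pi.π y j)))
    exact gm_inj this

lemma releq (c : C) [HasEqualizers (F.obj c)] {x y : F.obj c}
    (a b : (⟨c, x⟩ : Grothendieck F) ⟶ ⟨c, y⟩) (ha : a.base = 𝟙 c) (hb : b.base = 𝟙 c) :
    ∃ (w : F.obj c) (p : (⟨c, w⟩ : Grothendieck F) ⟶ ⟨c, x⟩),
      p.base = 𝟙 c ∧ p ≫ a = p ≫ b ∧
      (∀ (Z : Grothendieck F) (g : Z ⟶ ⟨c, x⟩), g ≫ a = g ≫ b →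
        ∃ g' : Z ⟶ ⟨c, w⟩, g'.base = g.base ∧ g' ≫ p = g) ∧
      (∀ (Z : Grothendieck F) (g g' : Z ⟶ ⟨c, w⟩), g.base = g'.base →
        g ≫ p = g' ≫ p → g = g') := by
  obtain ⟨a, rfl⟩ := exists_vert a ha
  obtain ⟨b, rfl⟩ := exists_vert b hb
  refine ⟨equalizer a b, vert (equalizer.ι a b), rfl, ?_, ?_, ?_⟩
  · rw [vert_comp, vert_comp, equalizer.condition]
  · intro Z g e
    obtain ⟨φ, hφ⟩ := exists_gm g rfl
    rw [hφ] at e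
    have := gm_inj ((gm_vert _ φ a).symm.trans (e.trans (gm_vert _ φ b)))
    refine ⟨gm (Y := ⟨c, equalizer a b⟩) g.base (equalizer.lift φ this), rfl, ?_⟩
    refine (gm_vert _ _ _).trans ?_
    rw [equalizer.lift_ι]
    exact hφ.symm
  · intro Z g g' e e'
    obtain ⟨h, φ, φ', rfl, rfl⟩ := exists_gm₂ g g' e
    congr 1
    refine equalizer.hom_ext ?_
    exact gm_inj ((gm_vert _ φ (equalizer.ι a b)).symm.trans
      (e'.trans (gm_vert _ φ' (equalizer.ι a b))))

lemma relcoprod (c : C) [HasCoproducts.{w₁} (F.obj c)] (J : Type w₁) (y : J → F.obj c) :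
    ∃ (w : F.obj c) (p : ∀ j, (⟨c, y j⟩ : Grothendieck F) ⟶ ⟨c, w⟩),
      (∀ j, (p j).base = 𝟙 c) ∧
      (∀ (Z : Grothendieck F) (h : c ⟶ Z.base) (g : ∀ j, (⟨c, y j⟩ : Grothendieck F) ⟶ Z),
        (∀ j, (g j).base = h) →
        ∃ g' : (⟨c, w⟩ : Grothendieck F) ⟶ Z, g'.base = h ∧ ∀ j, p j ≫ g' = g j) ∧
      (∀ (Z : Grothendieck F) (g g' : (⟨c, w⟩ : Grothendieck F) ⟶ Z), g.base = g'.base →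
        (∀ j, p j ≫ g = p j ≫ g') → g = g') := by
  refine ⟨∐ y, fun j => vert (Sigma.ι y j), fun _ => rfl, ?_, ?_⟩
  · intro Z h g e
    choose φ hφ using fun j => exists_gm (g j) (e j)
    let adj := Adjunction.ofIsLeftAdjoint (F.map h).toFunctor
    refine ⟨gm (X := ⟨c, ∐ y⟩) h ((adj.homEquiv _ _).symm
      (Sigma.desc fun j => adj.homEquiv _ _ (φ j))), rfl, fun j => ?_⟩
    rw [vert_gm, hφ j, ← Adjunction.homEquiv_naturality_left_symm]
    simp
  · intro Z g g' e e'
    obtain ⟨h, φ, φ', rfl, rfl⟩ := exists_gm₂ g g' e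
    congr 1
    let adj := Adjunction.ofIsLeftAdjoint (F.map h).toFunctor
    refine (adj.homEquiv _ _).injective (Sigma.hom_ext _ _ fun j => ?_)
    have := gm_inj ((vert_gm _ φ (Sigma.ι y j)).symm.trans
      ((e' j).trans (vert_gm _ φ' (Sigma.ι y j))))
    rw [← Adjunction.homEquiv_naturality_left, ← Adjunction.homEquiv_naturality_left]
    exact congrArg _ this

lemma relcoeq (c : C) [HasCoequalizers (F.obj c)] {x y : F.obj c}
    (a b : (⟨c, x⟩ : Grothendieck F) ⟶ ⟨c, y⟩) (ha : a.base = 𝟙 c) (hb : b.base = 𝟙 c) :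
    ∃ (w : F.obj c) (p : (⟨c, y⟩ : Grothendieck F) ⟶ ⟨c, w⟩),
      p.base = 𝟙 c ∧ a ≫ p = b ≫ p ∧
      (∀ (Z : Grothendieck F) (g : (⟨c, y⟩ : Grothendieck F) ⟶ Z), a ≫ g = b ≫ g →
        ∃ g' : (⟨c, w⟩ : Grothendieck F) ⟶ Z, g'.base = g.base ∧ p ≫ g' = g) ∧
      (∀ (Z : Grothendieck F) (g g' : (⟨c, w⟩ : Grothendieck F) ⟶ Z), g.base = g'.base →
        p ≫ g = p ≫ g' → g = g') := by
  obtain ⟨a, rfl⟩ := exists_vert a ha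
  obtain ⟨b, rfl⟩ := exists_vert b hb
  refine ⟨coequalizer a b, vert (coequalizer.π a b), rfl, ?_, ?_, ?_⟩
  · rw [vert_comp, vert_comp, coequalizer.condition]
  · intro Z g e
    obtain ⟨φ, hφ⟩ := exists_gm g rfl
    rw [hφ] at e
    have := gm_inj ((vert_gm _ φ a).symm.trans (e.trans (vert_gm _ φ b)))
    let adj := Adjunction.ofIsLeftAdjoint (F.map g.base).toFunctor
    refine ⟨gm (X := ⟨c, coequalizer a b⟩) g.base ((adj.homEquiv _ _).symm
      (coequalizer.desc (adj.homEquiv _ _ φ) ?_)), rfl, ?_⟩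
    · rw [← Adjunction.homEquiv_naturality_left, ← Adjunction.homEquiv_naturality_left]
      exact congrArg _ this
    · refine (vert_gm _ _ _).trans ?_
      rw [← Adjunction.homEquiv_naturality_left_symm, coequalizer.π_desc,
        Equiv.symm_apply_apply]
      exact hφ.symm
  · intro Z g g' e e'
    obtain ⟨h, φ, φ', rfl, rfl⟩ := exists_gm₂ g g' e
    congr 1
    let adj := Adjunction.ofIsLeftAdjoint (F.map h).toFunctor
    refine (adj.homEquiv _ _).injective (coequalizer.hom_ext ?_)
    rw [← Adjunction.homEquiv_naturality_left, ← Adjunction.homEquiv_naturality_left]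
    have := gm_inj ((vert_gm _ φ (coequalizer.π a b)).symm.trans
      (e'.trans (vert_gm _ φ' (coequalizer.π a b))))
    exact congrArg _ this

/-! ### products, equalizers, coproducts and coequalizers in the total category -/

lemma hasProducts [HasProducts.{w₁} C] [∀ c, HasProducts.{w₁} (F.obj c)] :
    HasProducts.{w₁} (Grothendieck F) := by
  refine fun J => ⟨fun K => ?_⟩
  suffices H : ∀ X : J → Grothendieck F, HasProduct X by
    have := H (fun j => K.obj ⟨j⟩)
    exact hasLimit_of_iso Discrete.natIsoFunctor.symm
  intro X
  let B : J → C := fun j => (X j).base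
  choose y φ hφ hφ₁ hφ₂ using fun j => cart_exists (X j) (Pi.π B j)
  obtain ⟨w, p, hp, hp₁, hp₂⟩ := relprod (∏ᶜ B) J y
  have hb : ∀ j, (p j ≫ φ j).base = Pi.π B j := fun j => by
    rw [Grothendieck.comp_base, hp, hφ]
    exact Category.id_comp _
  have main : ∀ (Z : Grothendieck F) (s : ∀ j, Z ⟶ X j),
      ∃ l : Z ⟶ ⟨∏ᶜ B, w⟩, ∀ j, l ≫ p j ≫ φ j = s j := by
    intro Z s
    let h : Z.base ⟶ ∏ᶜ B := Pi.lift fun j => (s j).base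
    choose t ht ht' using fun j => hφ₁ j Z h (s j) (by simp [h, B])
    obtain ⟨l, -, hl⟩ := hp₁ Z h t ht
    exact ⟨l, fun j => by rw [← Category.assoc, hl, ht']⟩
  have uniq : ∀ (Z : Grothendieck F) (l m : Z ⟶ ⟨∏ᶜ B, w⟩),
      (∀ j, l ≫ p j ≫ φ j = m ≫ p j ≫ φ j) → l = m := by
    intro Z l m e
    have eb : l.base = m.base := by
      refine Pi.hom_ext _ _ fun j => ?_
      have := congrArg Grothendieck.Hom.base (e j)
      rw [Grothendieck.comp_base _ (p j ≫ φ j), Grothendieck.comp_base _ (p j ≫ φ j), hb] at this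
      exact this
    refine hp₂ _ _ _ eb fun j => hφ₂ j _ _ _ ?_ ?_
    · rw [Grothendieck.comp_base, Grothendieck.comp_base, eb]
    · rw [Category.assoc, Category.assoc, e j]
  choose l hl using main
  exact ⟨⟨⟨Fan.mk _ fun j => p j ≫ φ j, Fan.IsLimit.mk _ (fun s => l _ s.proj)
    (fun s j => hl _ s.proj j)
    (fun s m hm => uniq _ _ _ fun j => (hm j).trans (hl _ s.proj j).symm)⟩⟩⟩

lemma hasEqualizers [HasEqualizers C] [∀ c, HasEqualizers (F.obj c)] :
    HasEqualizers (Grothendieck F) := by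
  suffices H : ∀ {X Y : Grothendieck F} {f g : X ⟶ Y}, HasLimit (parallelPair f g) from
    hasEqualizers_of_hasLimit_parallelPair _
  intro X Y f g
  let L := equalizer f.base g.base
  let e : L ⟶ X.base := equalizer.ι f.base g.base
  obtain ⟨x, φ, hφ, hφ₁, hφ₂⟩ := cart_exists X e
  obtain ⟨y, ψ, hψ, hψ₁, hψ₂⟩ := cart_exists Y (e ≫ f.base)
  obtain ⟨a, ha, ha'⟩ := hψ₁ _ (𝟙 L) (φ ≫ f) (by
    rw [Grothendieck.comp_base, hφ]; exact (Category.id_comp _).symm)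
  obtain ⟨b, hb, hb'⟩ := hψ₁ _ (𝟙 L) (φ ≫ g) (by
    rw [Grothendieck.comp_base, hφ]
    exact (equalizer.condition f.base g.base).symm.trans (Category.id_comp _).symm)
  obtain ⟨w, p, hp, hpe, hp₁, hp₂⟩ := releq L a b ha hb
  have hpb : (p ≫ φ).base = e := by
    rw [Grothendieck.comp_base, hp, hφ]
    exact Category.id_comp _
  have hc : (p ≫ φ) ≫ f = (p ≫ φ) ≫ g := by
    rw [Category.assoc, Category.assoc, ← ha', ← hb', ← Category.assoc, hpe, Category.assoc]
  refine ⟨⟨⟨Fork.ofι (p ≫ φ) hc, Fork.IsLimit.ofExistsUnique fun s => ?_⟩⟩⟩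
  have hs := s.condition
  have hsb := congrArg Grothendieck.Hom.base hs
  obtain ⟨t, ht, ht'⟩ := hφ₁ _ (equalizer.lift s.ι.base hsb) s.ι
    (equalizer.lift_ι _ _).symm
  obtain ⟨l, -, hl'⟩ := hp₁ _ t (hψ₂ _ _ _
    (by rw [Grothendieck.comp_base, Grothendieck.comp_base, ha, hb])
    (by rw [Category.assoc, Category.assoc, ha', hb', ← Category.assoc, ← Category.assoc, ht', hs]))
  have hl'' : l ≫ p ≫ φ = s.ι := by rw [← Category.assoc, hl', ht']
  refine ⟨l, hl'', fun m hm => ?_⟩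
  have hm : m ≫ p ≫ φ = s.ι := hm
  have eb : m.base = l.base := by
    refine equalizer.hom_ext ?_
    have := congrArg Grothendieck.Hom.base (hm.trans hl''.symm)
    rw [Grothendieck.comp_base _ (p ≫ φ), Grothendieck.comp_base _ (p ≫ φ), hpb] at this
    exact this
  refine hp₂ _ _ _ eb (hφ₂ _ _ _ ?_ ?_)
  · rw [Grothendieck.comp_base, Grothendieck.comp_base, eb]
  · rw [Category.assoc, Category.assoc, hm, hl'']

lemma hasCoproducts [HasCoproducts.{w₁} C] [∀ c, HasCoproducts.{w₁} (F.obj c)] :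
    HasCoproducts.{w₁} (Grothendieck F) := by
  refine fun J => ⟨fun K => ?_⟩
  suffices H : ∀ X : J → Grothendieck F, HasCoproduct X by
    have := H (fun j => K.obj ⟨j⟩)
    exact hasColimit_of_iso Discrete.natIsoFunctor
  intro X
  let B : J → C := fun j => (X j).base
  let φ := fun j => cocart (X j) (Sigma.ι B j)
  obtain ⟨w, p, hp, hp₁, hp₂⟩ := relcoprod (∐ B) J
    (fun j => (F.map (Sigma.ι B j)).toFunctor.obj (X j).fiber)
  have hb : ∀ j, (φ j ≫ p j).base = Sigma.ι B j := fun j => by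
    rw [Grothendieck.comp_base, hp]
    exact Category.comp_id _
  have main : ∀ (Z : Grothendieck F) (s : ∀ j, X j ⟶ Z),
      ∃ l : (⟨∐ B, w⟩ : Grothendieck F) ⟶ Z, ∀ j, (φ j ≫ p j) ≫ l = s j := by
    intro Z s
    let h : ∐ B ⟶ Z.base := Sigma.desc fun j => (s j).base
    choose t ht ht' using fun j => cocart_exists (X j) (Sigma.ι B j) h (s j) (by simp [h, B])
    obtain ⟨l, -, hl⟩ := hp₁ Z h t ht
    exact ⟨l, fun j => by rw [Category.assoc, hl, ht']⟩
  have uniq : ∀ (Z : Grothendieck F) (l m : (⟨∐ B, w⟩ : Grothendieck F) ⟶ Z),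
      (∀ j, (φ j ≫ p j) ≫ l = (φ j ≫ p j) ≫ m) → l = m := by
    intro Z l m e
    have eb : l.base = m.base := by
      refine Sigma.hom_ext _ _ fun j => ?_
      have := congrArg Grothendieck.Hom.base (e j)
      rw [Grothendieck.comp_base (φ j ≫ p j) _, Grothendieck.comp_base (φ j ≫ p j) _, hb] at this
      exact this
    refine hp₂ _ _ _ eb fun j => cocart_unique _ _ _ _ ?_ ?_
    · rw [Grothendieck.comp_base, Grothendieck.comp_base, eb]
    · rw [← Category.assoc, ← Category.assoc]
      exact e j
  choose l hl using main
  exact ⟨⟨⟨Cofan.mk _ fun j => φ j ≫ p j, Cofan.IsColimit.mk _ (fun s => l _ s.inj)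
    (fun s j => hl _ s.inj j)
    (fun s m hm => uniq _ _ _ fun j => (hm j).trans (hl _ s.inj j).symm)⟩⟩⟩

lemma hasCoequalizers [HasCoequalizers C] [∀ c, HasCoequalizers (F.obj c)] :
    HasCoequalizers (Grothendieck F) := by
  suffices H : ∀ {X Y : Grothendieck F} {f g : X ⟶ Y}, HasColimit (parallelPair f g) from
    hasCoequalizers_of_hasColimit_parallelPair _
  intro X Y f g
  let L := coequalizer f.base g.base
  let e : Y.base ⟶ L := coequalizer.π f.base g.base
  let φ := cocart Y e
  let ψ := cocart X (f.base ≫ e)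
  obtain ⟨a, ha, ha'⟩ := cocart_exists X (f.base ≫ e) (𝟙 L) (f ≫ φ) (Category.comp_id _).symm
  obtain ⟨b, hb, hb'⟩ := cocart_exists X (f.base ≫ e) (𝟙 L) (g ≫ φ)
    ((coequalizer.condition f.base g.base).symm.trans (Category.comp_id _).symm)
  obtain ⟨w, p, hp, hpe, hp₁, hp₂⟩ := relcoeq L a b ha hb
  have hpb : (φ ≫ p).base = e := by
    rw [Grothendieck.comp_base, hp]
    exact Category.comp_id _
  have hc : f ≫ φ ≫ p = g ≫ φ ≫ p := by
    rw [← Category.assoc, ← Category.assoc, ← ha', ← hb', Category.assoc, hpe, Category.assoc]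
  refine ⟨⟨⟨Cofork.ofπ (φ ≫ p) hc, Cofork.IsColimit.ofExistsUnique fun s => ?_⟩⟩⟩
  have hs := s.condition
  have hsb := congrArg Grothendieck.Hom.base hs
  obtain ⟨t, ht, ht'⟩ := cocart_exists Y e (coequalizer.desc s.π.base hsb) s.π
    (coequalizer.π_desc _ _).symm
  obtain ⟨l, -, hl'⟩ := hp₁ _ t (cocart_unique X (f.base ≫ e) _ _
    (by rw [Grothendieck.comp_base, Grothendieck.comp_base, ha, hb])
    (by rw [← Category.assoc, ← Category.assoc, ha', hb', Category.assoc, Category.assoc, ht', hs]))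
  have hl'' : (φ ≫ p) ≫ l = s.π := by rw [Category.assoc, hl', ht']
  refine ⟨l, hl'', fun m hm => ?_⟩
  have hm : (φ ≫ p) ≫ m = s.π := hm
  have eb : m.base = l.base := by
    refine coequalizer.hom_ext ?_
    have := congrArg Grothendieck.Hom.base (hm.trans hl''.symm)
    rw [Grothendieck.comp_base (φ ≫ p) _, Grothendieck.comp_base (φ ≫ p) _, hpb] at this
    exact this
  refine hp₂ _ _ _ eb (cocart_unique _ _ _ _ ?_ ?_)
  · rw [Grothendieck.comp_base, Grothendieck.comp_base, eb]
  · rw [← Category.assoc, ← Category.assoc]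
    exact hm.trans hl''.symm

/-! ### the projection has both adjoints -/

lemma isRightAdjoint_forget [∀ c, HasInitial (F.obj c)] :
    (Grothendieck.forget F).IsRightAdjoint := by
  have hI : ∀ {c d : C} (k : c ⟶ d), IsInitial ((F.map k).toFunctor.obj (⊥_ (F.obj c))) :=
    fun k => IsInitial.isInitialObj _ _ initialIsInitial
  let e : ∀ (c : C) (Y : Grothendieck F),
      ((⟨c, ⊥_ (F.obj c)⟩ : Grothendieck F) ⟶ Y) ≃ (c ⟶ (Grothendieck.forget F).obj Y) :=
    fun c Y =>
      { toFun := fun g => g.base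
        invFun := fun h => gm (X := ⟨c, ⊥_ (F.obj c)⟩) h ((hI h).to _)
        left_inv := fun g => by
          obtain ⟨φ, hφ⟩ := exists_gm g rfl
          conv_rhs => rw [hφ]
          exact congrArg (gm (X := ⟨c, ⊥_ (F.obj c)⟩) g.base) ((hI g.base).hom_ext _ _)
        right_inv := fun h => rfl }
  exact (Adjunction.adjunctionOfEquivLeft e (fun _ _ _ _ _ => rfl)).isRightAdjoint

lemma isLeftAdjoint_forget [∀ c, HasTerminal (F.obj c)] :
    (Grothendieck.forget F).IsLeftAdjoint := by
  let e : ∀ (Y : Grothendieck F) (c : C),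
      ((Grothendieck.forget F).obj Y ⟶ c) ≃ (Y ⟶ (⟨c, ⊤_ (F.obj c)⟩ : Grothendieck F)) :=
    fun Y c =>
      { toFun := fun h => gm (Y := ⟨c, ⊤_ (F.obj c)⟩) h (terminal.from _)
        invFun := fun g => g.base
        right_inv := fun g => by
          obtain ⟨φ, hφ⟩ := exists_gm g rfl
          conv_rhs => rw [hφ]
          exact congrArg (gm (Y := ⟨c, ⊤_ (F.obj c)⟩) g.base)
            ((terminalIsTerminal (C := F.obj c)).hom_ext _ _)
        left_inv := fun h => rfl }
  refine (Adjunction.adjunctionOfEquivRight e (fun Y' Y c f g => ?_)).isLeftAdjoint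
  exact (e _ _).symm.injective rfl

end General

end SchemaAux

/-- The context of schemas, i.e. the diagram context over the arrow category
`Arrow (Type u)` (the category of signatures: functions `s : I → X` between types),
has all limits and colimits indexed by small categories, and its projection to `Catᵒᵖ`
preserves all such limits and colimits. -/
theorem schemaContext_hasLimits_hasColimits_and_forget_preserves :
    (HasLimitsOfSize.{u, u} (Grothendieck (diagramContextFunctor.{u} (Arrow (Type u)))) ∧
      HasColimitsOfSize.{u, u} (Grothendieck (diagramContextFunctor.{u} (Arrow (Type u))))) ∧
    (PreservesLimitsOfSize.{u, u}
        (Grothendieck.forget (diagramContextFunctor.{u} (Arrow (Type u)))) ∧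
      PreservesColimitsOfSize.{u, u}
        (Grothendieck.forget (diagramContextFunctor.{u} (Arrow (Type u))))) := by
  have : ∀ {c d : Cat.{u, u}ᵒᵖ} (k : c ⟶ d),
      ((diagramContextFunctor.{u} (Arrow (Type u))).map k).toFunctor.IsLeftAdjoint := fun k =>
    (Functor.ranAdjunction k.unop.toFunctor (Arrow (Type u))).isLeftAdjoint
  have hl : ∀ c, HasLimitsOfSize.{u, u} ((diagramContextFunctor.{u} (Arrow (Type u))).obj c) :=
    fun c => inferInstanceAs (HasLimitsOfSize.{u, u} (c.unop ⥤ Arrow (Type u)))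
  have hc : ∀ c, HasColimitsOfSize.{u, u} ((diagramContextFunctor.{u} (Arrow (Type u))).obj c) :=
    fun c => inferInstanceAs (HasColimitsOfSize.{u, u} (c.unop ⥤ Arrow (Type u)))
  have i₁ : HasLimitsOfSize.{u, u} Cat.{u, u}ᵒᵖ := inferInstance
  have i₂ : HasColimitsOfSize.{u, u} Cat.{u, u}ᵒᵖ := inferInstance
  have : ∀ c, HasInitial ((diagramContextFunctor.{u} (Arrow (Type u))).obj c) :=
    fun c => inferInstance
  have e₁ : ∀ c, HasEqualizers ((diagramContextFunctor.{u} (Arrow (Type u))).obj c) :=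
    fun c => inferInstance
  have e₂ : ∀ c, HasCoequalizers ((diagramContextFunctor.{u} (Arrow (Type u))).obj c) :=
    fun c => inferInstance
  have t : ∀ c, HasTerminal ((diagramContextFunctor.{u} (Arrow (Type u))).obj c) :=
    fun c => inferInstance
  have p₁ := SchemaAux.hasProducts.{u} (F := diagramContextFunctor.{u} (Arrow (Type u)))
  have p₂ := SchemaAux.hasEqualizers (F := diagramContextFunctor.{u} (Arrow (Type u)))
  have p₃ := SchemaAux.hasCoproducts.{u} (F := diagramContextFunctor.{u} (Arrow (Type u)))
  have p₄ := SchemaAux.hasCoequalizers (F := diagramContextFunctor.{u} (Arrow (Type u)))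
  have r := SchemaAux.isRightAdjoint_forget (F := diagramContextFunctor.{u} (Arrow (Type u)))
  have l := SchemaAux.isLeftAdjoint_forget (F := diagramContextFunctor.{u} (Arrow (Type u)))
  exact ⟨⟨has_limits_of_hasEqualizers_and_products,
    has_colimits_of_hasCoequalizers_and_coproducts⟩,
    (Adjunction.ofIsRightAdjoint _).rightAdjoint_preservesLimits,
    (Adjunction.ofIsLeftAdjoint _).leftAdjoint_preservesColimits⟩
end

section
/- For every type X : Type u, the diagram context over the over category Over X of Type u (the context of X-sorted schemed domains) has all limits and all colimits indexed by small categories, and its projection functor to Catᵒᵖ, sending (B, D) to B, preserves all such limits and colimits. -/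
open CategoryTheory CategoryTheory.Limits

universe w v u

namespace GrothAux

universe v₁ u₁ v₂ u₂ v₃ u₃

variable {C : Type u₁} [Category.{v₁} C] {F : C ⥤ Cat.{v₂, u₂}}

/-- The hom of a Grothendieck construction with given components. -/
abbrev mk {x y : Grothendieck F} (u : x.base ⟶ y.base)
    (a : (F.map u).toFunctor.obj x.fiber ⟶ y.fiber) : x ⟶ y := Grothendieck.Hom.mk u a

lemma mk_inj {x y : Grothendieck F} {u : x.base ⟶ y.base}
    {a b : (F.map u).toFunctor.obj x.fiber ⟶ y.fiber} (h : mk u a = mk u b) : a = b := by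
  have := congrArg (fun (f : x ⟶ y) => (⟨f.base, f.fiber⟩ :
    Σ u : x.base ⟶ y.base, ((F.map u).toFunctor.obj x.fiber ⟶ y.fiber))) h
  simpa using this

lemma exists_mk {x y : Grothendieck F} (g : x ⟶ y) (u : x.base ⟶ y.base) (h : g.base = u) :
    ∃ a, g = mk u a := by
  subst h; exact ⟨g.fiber, rfl⟩

lemma eq1 {D : Type*} [Category D] {a b : D} (p : a = a) (f : a ⟶ b) :
    eqToHom p ≫ f = f := by simp

lemma eq3 {D : Type*} [Category D] {a b c d : D} (p : a = b) (q : b = c) (r : c = a) (f : a ⟶ d) :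
    eqToHom p ≫ eqToHom q ≫ eqToHom r ≫ f = f := by subst p q; simp

lemma eq2 {D : Type*} [Category D] {a b c d : D} (p : a = b) (q : b = c) (f : c ⟶ d) :
    eqToHom p ≫ eqToHom q ≫ f = eqToHom (p.trans q) ≫ f := by subst p q; simp

lemma comp_ι {x : Grothendieck F} {c : C} {d d' : F.obj c} (u : x.base ⟶ c)
    (a : (F.map u).toFunctor.obj x.fiber ⟶ d) (t : d ⟶ d') :
    (mk (y := ⟨c, d⟩) u a : x ⟶ ⟨c, d⟩) ≫ (Grothendieck.ι F c).map t =
      mk (y := ⟨c, d'⟩) u (a ≫ t) := by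
  apply Grothendieck.ext
  swap
  · change u ≫ 𝟙 _ = u
    simp
  · have := Functor.congr_hom congr($(F.map_id c).toFunctor) a
    dsimp [Grothendieck.ι, mk]
    rw [this]
    simp
    exact eq3 _ _ _ _

lemma ι_comp {x : Grothendieck F} {c : C} {d d' : F.obj c} (u : c ⟶ x.base)
    (a : (F.map u).toFunctor.obj d' ⟶ x.fiber) (t : d ⟶ d') :
    (Grothendieck.ι F c).map t ≫ (mk (x := ⟨c, d'⟩) u a : ⟨c, d'⟩ ⟶ x) =
      mk (x := ⟨c, d⟩) u ((F.map u).toFunctor.map t ≫ a) := by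
  apply Grothendieck.ext
  swap
  · change 𝟙 _ ≫ u = u
    simp
  · dsimp [Grothendieck.ι, mk]
    simp [eqToHom_map]
    exact eq3 _ _ _ _

lemma exists_ι {c : C} {d d' : F.obj c} (g : (⟨c, d⟩ : Grothendieck F) ⟶ ⟨c, d'⟩)
    (h : g.base = 𝟙 c) : ∃ t : d ⟶ d', (Grothendieck.ι F c).map t = g := by
  obtain ⟨a, rfl⟩ := exists_mk g _ h
  refine ⟨eqToHom (by simp) ≫ a, ?_⟩
  apply Grothendieck.ext
  swap
  · rfl
  · dsimp [Grothendieck.ι, mk]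
    simp
    exact eq1 _ _

lemma cart {y : Grothendieck F} {c : C} (p : c ⟶ y.base) [(F.map p).toFunctor.IsLeftAdjoint] :
    ∃ (r : F.obj c) (ε : (Grothendieck.ι F c).obj r ⟶ y), ε.base = p ∧
      ∀ (x : Grothendieck F) (u : x.base ⟶ c) (g : x ⟶ y), g.base = u ≫ p →
        ∃! h : x ⟶ (Grothendieck.ι F c).obj r, h.base = u ∧ h ≫ ε = g := by
  let adj := Adjunction.ofIsLeftAdjoint (F.map p).toFunctor
  refine ⟨(F.map p).toFunctor.rightAdjoint.obj y.fiber,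
    mk (x := ⟨c, _⟩) p (adj.counit.app _), rfl, ?_⟩
  intro x u g hg
  obtain ⟨b, rfl⟩ := exists_mk g _ hg
  have key : ∀ a, (mk (y := ⟨c, (F.map p).toFunctor.rightAdjoint.obj y.fiber⟩) u a) ≫
      (mk (x := ⟨c, _⟩) (y := y) p (adj.counit.app _)) = mk (u ≫ p)
      (eqToHom (by simp) ≫ (adj.homEquiv _ _).symm a) := by
    intro a
    rw [Adjunction.homEquiv_counit]
    rfl
  refine ⟨mk (y := ⟨c, _⟩) u (adj.homEquiv _ _ (eqToHom (by simp) ≫ b)), ⟨rfl, ?_⟩, ?_⟩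
  · refine (key _).trans ?_
    simp
  · rintro h ⟨hu, hh⟩
    obtain ⟨a, rfl⟩ := exists_mk h _ hu
    congr 1
    have := mk_inj ((key a).symm.trans hh)
    rw [← this]
    simp
    exact ((adj.homEquiv _ _).apply_symm_apply _).symm

lemma cocart {y : Grothendieck F} {c : C} (p : y.base ⟶ c) :
    ∃ (r : F.obj c) (ε : y ⟶ (Grothendieck.ι F c).obj r), ε.base = p ∧
      ∀ (x : Grothendieck F) (u : c ⟶ x.base) (g : y ⟶ x), g.base = p ≫ u →
        ∃! h : (Grothendieck.ι F c).obj r ⟶ x, h.base = u ∧ ε ≫ h = g := by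
  refine ⟨(F.map p).toFunctor.obj y.fiber, mk (y := ⟨c, _⟩) p (𝟙 _), rfl, ?_⟩
  intro x u g hg
  obtain ⟨b, rfl⟩ := exists_mk g _ hg
  have key : ∀ a, (mk (x := y) (y := ⟨c, (F.map p).toFunctor.obj y.fiber⟩) p (𝟙 _)) ≫
      (mk (x := ⟨c, _⟩) (y := x) u a) = mk (p ≫ u) (eqToHom (by simp) ≫ a) := by
    intro a
    apply Grothendieck.ext
    swap
    · rfl
    · dsimp [mk]
      simp
      exact eq2 _ _ _
  refine ⟨mk (x := ⟨c, _⟩) u (eqToHom (by simp) ≫ b), ⟨rfl, ?_⟩, ?_⟩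
  · refine (key _).trans ?_
    simp
  · rintro h ⟨hu, hh⟩
    obtain ⟨a, rfl⟩ := exists_mk h _ hu
    congr 1
    have := mk_inj ((key a).symm.trans hh)
    rw [← this]
    exact ((eq2 _ _ _).trans (eq1 _ _)).symm

variable {J : Type u₃} [Category.{v₃} J]

lemma fiblim {c : C} (T : J ⥤ F.obj c) (k : Cone T) (hk : IsLimit k)
    (x : Grothendieck F) (u : x.base ⟶ c)
    (g : ∀ j, x ⟶ (Grothendieck.ι F c).obj (T.obj j)) (hg : ∀ j, (g j).base = u)
    (hc : ∀ ⦃i j⦄ (f : i ⟶ j), g i ≫ (Grothendieck.ι F c).map (T.map f) = g j) :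
    ∃! h : x ⟶ (Grothendieck.ι F c).obj k.pt, h.base = u ∧
      ∀ j, h ≫ (Grothendieck.ι F c).map (k.π.app j) = g j := by
  choose a ha using fun j => exists_mk (g j) u (hg j)
  have hc' : ∀ ⦃i j⦄ (f : i ⟶ j), a i ≫ T.map f = a j := by
    intro i j f
    have := hc f
    rw [ha i, ha j] at this
    exact mk_inj ((comp_ι u (a i) (T.map f)).symm.trans this)
  let s : Cone T := ⟨(F.map u).toFunctor.obj x.fiber,
    { app := a, naturality := fun i j f => by
        exact (Category.id_comp _).trans (hc' f).symm }⟩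
  refine ⟨mk (y := ⟨c, k.pt⟩) u (hk.lift s), ⟨rfl, ?_⟩, ?_⟩
  · intro j
    refine (comp_ι u (hk.lift s) _).trans ?_
    rw [hk.fac, ha j]
    rfl
  · rintro h ⟨hu, hh⟩
    obtain ⟨b, rfl⟩ := exists_mk h _ hu
    congr 1
    refine hk.uniq s b ?_
    intro j
    exact mk_inj ((comp_ι u b _).symm.trans ((hh j).trans (ha j)))

lemma fibcolim {c : C} (T : J ⥤ F.obj c) (k : Cocone T)
    (x : Grothendieck F) (u : c ⟶ x.base) (hk : IsColimit ((F.map u).toFunctor.mapCocone k))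
    (g : ∀ j, (Grothendieck.ι F c).obj (T.obj j) ⟶ x) (hg : ∀ j, (g j).base = u)
    (hc : ∀ ⦃i j⦄ (f : i ⟶ j), (Grothendieck.ι F c).map (T.map f) ≫ g j = g i) :
    ∃! h : (Grothendieck.ι F c).obj k.pt ⟶ x, h.base = u ∧
      ∀ j, (Grothendieck.ι F c).map (k.ι.app j) ≫ h = g j := by
  choose a ha using fun j => exists_mk (g j) u (hg j)
  have hc' : ∀ ⦃i j⦄ (f : i ⟶ j), (F.map u).toFunctor.map (T.map f) ≫ a j = a i := by
    intro i j f
    have := hc f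
    rw [ha i, ha j] at this
    exact mk_inj ((ι_comp u (a j) (T.map f)).symm.trans this)
  let s : Cocone (T ⋙ (F.map u).toFunctor) := ⟨x.fiber,
    { app := a, naturality := fun i j f => by
        refine (hc' f).trans ?_
        exact (Category.comp_id _).symm }⟩
  refine ⟨mk (x := ⟨c, k.pt⟩) u (hk.desc s), ⟨rfl, ?_⟩, ?_⟩
  · intro j
    refine (ι_comp u (hk.desc s) _).trans ?_
    rw [ha j]
    congr 1
    exact hk.fac s j
  · rintro h ⟨hu, hh⟩
    obtain ⟨b, rfl⟩ := exists_mk h _ hu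
    congr 1
    refine hk.uniq s b ?_
    intro j
    exact mk_inj ((ι_comp u b _).symm.trans ((hh j).trans (ha j)))

lemma ι_inj {c : C} {d d' : F.obj c} {s t : d ⟶ d'}
    (h : (Grothendieck.ι F c).map s = (Grothendieck.ι F c).map t) : s = t :=
  (Grothendieck.ι F c).map_injective h

lemma exists_limit [∀ c, HasLimitsOfShape J (F.obj c)]
    (hF : ∀ {c d : C} (p : c ⟶ d), (F.map p).toFunctor.IsLeftAdjoint)
    (G : J ⥤ Grothendieck F) (L : Cone (G ⋙ Grothendieck.forget F)) (hL : IsLimit L) :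
    ∃ s : Cone G, Nonempty (IsLimit s) ∧ Nonempty (IsLimit ((Grothendieck.forget F).mapCone s)) := by
  choose r ε hε hu using fun j => (@cart _ _ F (G.obj j) L.pt (L.π.app j) (hF _))
  have hw : ∀ {i j : J} (f : i ⟶ j), L.π.app i ≫ (G.map f).base = L.π.app j := fun f => L.w f
  have ht : ∀ {i j : J} (f : i ⟶ j), ∃ t : r i ⟶ r j,
      (Grothendieck.ι F L.pt).map t ≫ ε j = ε i ≫ G.map f := by
    intro i j f
    obtain ⟨h, ⟨h1, h2⟩, -⟩ := hu j ((Grothendieck.ι F L.pt).obj (r i)) (𝟙 _) (ε i ≫ G.map f) (by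
      rw [Grothendieck.comp_base, hε]
      exact (hw f).trans (Category.id_comp _).symm)
    obtain ⟨t, rfl⟩ := exists_ι h h1
    exact ⟨t, h2⟩
  choose t ht using @ht
  have hinj : ∀ {j} {d : F.obj L.pt} (a b : d ⟶ r j),
      (Grothendieck.ι F L.pt).map a ≫ ε j = (Grothendieck.ι F L.pt).map b ≫ ε j → a = b := by
    intro j d a b hab
    apply ι_inj
    refine (hu j ((Grothendieck.ι F L.pt).obj (d)) (𝟙 _) ((Grothendieck.ι F L.pt).map b ≫ ε j) ?_).unique
      ⟨rfl, hab⟩ ⟨rfl, rfl⟩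
    rw [Grothendieck.comp_base, hε]
    rfl
  let T : J ⥤ F.obj L.pt :=
    { obj := r
      map := t
      map_id := fun j => hinj _ _ (by
        rw [ht, CategoryTheory.Functor.map_id, Category.comp_id, CategoryTheory.Functor.map_id,
          Category.id_comp])
      map_comp := fun f g => hinj _ _ (by
        rw [ht, Functor.map_comp, Functor.map_comp, Category.assoc, ht, ← Category.assoc, ← ht f,
          Category.assoc]) }
  let k := limit.cone T
  let s : Cone G := ⟨(Grothendieck.ι F L.pt).obj k.pt,
    { app := fun j => (Grothendieck.ι F L.pt).map (k.π.app j) ≫ ε j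
      naturality := fun i j f => by
        refine (Category.id_comp _).trans ?_
        rw [Category.assoc, ← ht f, ← k.w f, Functor.map_comp, Category.assoc] }⟩
  have hsb : ∀ j, (s.π.app j).base = L.π.app j := by
    intro j
    change ((Grothendieck.ι F L.pt).map (k.π.app j) ≫ ε j).base = _
    rw [Grothendieck.comp_base, hε]
    exact Category.id_comp _
  have hs2 : IsLimit ((Grothendieck.forget F).mapCone s) :=
    hL.ofIsoLimit (Cone.ext (Iso.refl _) (fun j => by
      refine Eq.trans ?_ (Category.id_comp _).symm
      exact (hsb j).symm))
  refine ⟨s, ⟨?_⟩, ⟨hs2⟩⟩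
  have main : ∀ c : Cone G, ∃! h : c.pt ⟶ s.pt, ∀ j, h ≫ s.π.app j = c.π.app j := by
    intro c
    let u : c.pt.base ⟶ L.pt := hL.lift ((Grothendieck.forget F).mapCone c)
    have hub : ∀ j, u ≫ L.π.app j = (c.π.app j).base :=
      fun j => hL.fac ((Grothendieck.forget F).mapCone c) j
    choose g hg hgu using fun j => hu j c.pt u (c.π.app j) (hub j).symm
    obtain ⟨h, ⟨h1, h2⟩, h3⟩ := fiblim T k (limit.isLimit T) c.pt u g (fun j => (hg j).1)
      (fun i j f => by
        apply hgu j
        refine ⟨?_, ?_⟩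
        · rw [Grothendieck.comp_base, (hg i).1]
          exact Category.comp_id _
        · rw [Category.assoc]
          refine (congrArg (g i ≫ ·) (ht f)).trans ?_
          change g i ≫ ε i ≫ G.map f = _
          rw [reassoc_of% (hg i).2]
          exact c.w f)
    refine ⟨h, fun j => ?_, ?_⟩
    · change h ≫ (Grothendieck.ι F L.pt).map (k.π.app j) ≫ ε j = _
      rw [← Category.assoc, h2 j]
      exact (hg j).2
    · intro h' hh'
      have hb : h'.base = u := by
        apply hL.hom_ext
        intro j
        rw [hub, ← hh' j, Grothendieck.comp_base, hsb]
        rfl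
      refine h3 h' ⟨hb, fun j => ?_⟩
      apply hgu j
      refine ⟨?_, ?_⟩
      · rw [Grothendieck.comp_base, hb]
        exact Category.comp_id _
      · rw [Category.assoc]
        exact hh' j
  exact { lift := fun c => (main c).choose
          fac := fun c j => (main c).choose_spec.1 j
          uniq := fun c m hm => (main c).choose_spec.2 m hm }

lemma exists_colimit [∀ c, HasColimitsOfShape J (F.obj c)]
    [∀ {c d : C} (p : c ⟶ d), PreservesColimitsOfShape J (F.map p).toFunctor]
    (G : J ⥤ Grothendieck F) (L : Cocone (G ⋙ Grothendieck.forget F)) (hL : IsColimit L) :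
    ∃ s : Cocone G, Nonempty (IsColimit s) ∧
      Nonempty (IsColimit ((Grothendieck.forget F).mapCocone s)) := by
  choose r ε hε hu using fun j => (cocart (F := F) (y := G.obj j) (c := L.pt) (L.ι.app j))
  have hw : ∀ {i j : J} (f : i ⟶ j), (G.map f).base ≫ L.ι.app j = L.ι.app i := fun f => L.w f
  have ht : ∀ {i j : J} (f : i ⟶ j), ∃ t : r i ⟶ r j,
      ε i ≫ (Grothendieck.ι F L.pt).map t = G.map f ≫ ε j := by
    intro i j f
    obtain ⟨h, ⟨h1, h2⟩, -⟩ := hu i ((Grothendieck.ι F L.pt).obj (r j)) (𝟙 _) (G.map f ≫ ε j) (by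
      rw [Grothendieck.comp_base, hε]
      exact (hw f).trans (Category.comp_id _).symm)
    obtain ⟨t, rfl⟩ := exists_ι h h1
    exact ⟨t, h2⟩
  choose t ht using @ht
  have hinj : ∀ {j} {d : F.obj L.pt} (a b : r j ⟶ d),
      ε j ≫ (Grothendieck.ι F L.pt).map a = ε j ≫ (Grothendieck.ι F L.pt).map b → a = b := by
    intro j d a b hab
    apply ι_inj
    refine (hu j ((Grothendieck.ι F L.pt).obj (d)) (𝟙 _) (ε j ≫ (Grothendieck.ι F L.pt).map b) ?_).unique
      ⟨rfl, hab⟩ ⟨rfl, rfl⟩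
    rw [Grothendieck.comp_base, hε]
    rfl
  let T : J ⥤ F.obj L.pt :=
    { obj := r
      map := t
      map_id := fun j => hinj _ _ (by
        rw [ht, CategoryTheory.Functor.map_id, Category.id_comp, CategoryTheory.Functor.map_id]
        exact (Category.comp_id _).symm)
      map_comp := fun f g => hinj _ _ (by
        rw [ht, Functor.map_comp, Functor.map_comp, ← Category.assoc (ε _), ht, Category.assoc,
          Category.assoc, ht]) }
  let k := colimit.cocone T
  let s : Cocone G := ⟨(Grothendieck.ι F L.pt).obj k.pt,
    { app := fun j => ε j ≫ (Grothendieck.ι F L.pt).map (k.ι.app j)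
      naturality := fun i j f => by
        refine Eq.trans ?_ (Category.comp_id _).symm
        rw [← Category.assoc, ← ht f, ← k.w f, Functor.map_comp, Category.assoc] }⟩
  have hsb : ∀ j, (s.ι.app j).base = L.ι.app j := by
    intro j
    change (ε j ≫ (Grothendieck.ι F L.pt).map (k.ι.app j)).base = _
    rw [Grothendieck.comp_base, hε]
    exact Category.comp_id _
  have hs2 : IsColimit ((Grothendieck.forget F).mapCocone s) :=
    hL.ofIsoColimit (Cocone.ext (Iso.refl _) (fun j => by
      refine (Category.comp_id _).trans ?_
      exact (hsb j).symm))
  refine ⟨s, ⟨?_⟩, ⟨hs2⟩⟩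
  have main : ∀ c : Cocone G, ∃! h : s.pt ⟶ c.pt, ∀ j, s.ι.app j ≫ h = c.ι.app j := by
    intro c
    let u : L.pt ⟶ c.pt.base := hL.desc ((Grothendieck.forget F).mapCocone c)
    have hub : ∀ j, L.ι.app j ≫ u = (c.ι.app j).base :=
      fun j => hL.fac ((Grothendieck.forget F).mapCocone c) j
    choose g hg hgu using fun j => hu j c.pt u (c.ι.app j) (hub j).symm
    obtain ⟨h, ⟨h1, h2⟩, h3⟩ := fibcolim T k c.pt u
      (isColimitOfPreserves _ (colimit.isColimit T)) g (fun j => (hg j).1)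
      (fun i j f => by
        apply hgu i
        refine ⟨?_, ?_⟩
        · rw [Grothendieck.comp_base, (hg j).1]
          exact Category.id_comp _
        · rw [← Category.assoc]
          refine (congrArg (· ≫ g j) (ht f)).trans ?_
          rw [Category.assoc, (hg j).2]
          exact c.w f)
    refine ⟨h, fun j => ?_, ?_⟩
    · change (ε j ≫ (Grothendieck.ι F L.pt).map (k.ι.app j)) ≫ h = _
      rw [Category.assoc, h2 j]
      exact (hg j).2
    · intro h' hh'
      have hb : h'.base = u := by
        apply hL.hom_ext
        intro j
        rw [hub, ← hh' j, Grothendieck.comp_base, hsb]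
        rfl
      refine h3 h' ⟨hb, fun j => ?_⟩
      apply hgu j
      refine ⟨?_, ?_⟩
      · rw [Grothendieck.comp_base, hb]
        exact Category.id_comp _
      · rw [← Category.assoc]
        exact hh' j
  exact { desc := fun c => (main c).choose
          fac := fun c j => (main c).choose_spec.1 j
          uniq := fun c m hm => (main c).choose_spec.2 m hm }

end GrothAux

/-- For every type `X`, the diagram context over the over category `Over X`
of `Type u` (the context of `X`-sorted schemed domains) has all limits and colimits indexed
by small categories, and its projection to `Catᵒᵖ` preserves all such limits and colimits. -/
theorem sortedSchemedDomainContext_hasLimits_hasColimits_and_forget_preserves (X : Type u) :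
    (HasLimitsOfSize.{u, u} (Grothendieck (diagramContextFunctor.{u} (Over X))) ∧
      HasColimitsOfSize.{u, u} (Grothendieck (diagramContextFunctor.{u} (Over X)))) ∧
    (PreservesLimitsOfSize.{u, u}
        (Grothendieck.forget (diagramContextFunctor.{u} (Over X))) ∧
      PreservesColimitsOfSize.{u, u}
        (Grothendieck.forget (diagramContextFunctor.{u} (Over X)))) := by
  have i0 : HasLimitsOfSize.{u, u} (Over X) := inferInstance
  have i1 : ∀ {c d : Cat.{u, u}ᵒᵖ} (p : c ⟶ d),
      ((diagramContextFunctor.{u} (Over X)).map p).toFunctor.IsLeftAdjoint := by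
    intro c d p
    exact (p.unop.toFunctor.ranAdjunction (Over X)).isLeftAdjoint
  have i2 : ∀ c : Cat.{u, u}ᵒᵖ,
      HasLimitsOfSize.{u, u} ((diagramContextFunctor.{u} (Over X)).obj c) := by
    intro c
    exact (inferInstance : HasLimitsOfSize.{u, u} (c.unop ⥤ Over X))
  have i3 : ∀ c : Cat.{u, u}ᵒᵖ,
      HasColimitsOfSize.{u, u} ((diagramContextFunctor.{u} (Over X)).obj c) := by
    intro c
    exact (inferInstance : HasColimitsOfSize.{u, u} (c.unop ⥤ Over X))
  have i4 : HasColimitsOfSize.{u, u} Cat.{u, u}ᵒᵖ := inferInstance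
  have i5 : HasLimitsOfSize.{u, u} Cat.{u, u}ᵒᵖ := inferInstance
  have i6 : ∀ {c d : Cat.{u, u}ᵒᵖ} (p : c ⟶ d),
      PreservesColimitsOfSize.{u, u}
        ((diagramContextFunctor.{u} (Over X)).map p).toFunctor := fun p =>
    (Adjunction.ofIsLeftAdjoint _).leftAdjoint_preservesColimits
  have hl := fun (J : Type u) [Category.{u} J]
    (G : J ⥤ Grothendieck (diagramContextFunctor.{u} (Over X))) =>
      GrothAux.exists_limit (F := diagramContextFunctor.{u} (Over X)) i1 G (limit.cone _) (limit.isLimit _)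
  have hc := fun (J : Type u) [Category.{u} J]
    (G : J ⥤ Grothendieck (diagramContextFunctor.{u} (Over X))) =>
      GrothAux.exists_colimit (F := diagramContextFunctor.{u} (Over X)) G (colimit.cocone _) (colimit.isColimit _)
  refine ⟨⟨⟨fun J _ => ⟨fun G => ?_⟩⟩, ⟨fun J _ => ⟨fun G => ?_⟩⟩⟩,
    ⟨⟨fun {J} _ => ⟨fun {G} => ?_⟩⟩, ⟨fun {J} _ => ⟨fun {G} => ?_⟩⟩⟩⟩
  · obtain ⟨s, ⟨h⟩, -⟩ := hl J G
    exact ⟨⟨⟨s, h⟩⟩⟩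
  · obtain ⟨s, ⟨h⟩, -⟩ := hc J G
    exact ⟨⟨⟨s, h⟩⟩⟩
  · obtain ⟨s, ⟨h⟩, ⟨h'⟩⟩ := hl J G
    exact preservesLimit_of_preserves_limit_cone h h'
  · obtain ⟨s, ⟨h⟩, ⟨h'⟩⟩ := hc J G
    exact preservesColimit_of_preserves_colimit_cocone h h'
end

section
/- For every type domain (X, Y, r) with X Y : Type u and r : X → Y → Prop, the table category Tbl(X,Y,r) = Comma (𝟭 (Type u)) tup has all small limits and all small colimits. -/
open CategoryTheory CategoryTheory.Limits

universe u

/-- The tuple functor of a type domain `(X, Y, r)`: it sends an `X`-sorted signature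
`(I, s : I → X)` to the set of `r`-compatible `Y`-valued tuples on `I`, contravariantly. -/
@[simps]
def tup {X : Type u} (Y : Type u) (r : X → Y → Prop) : (Over X)ᵒᵖ ⥤ Type u where
  obj S := { t : S.unop.left → Y // ∀ i, r (S.unop.hom i) (t i) }
  map {S₁ S₂} h := TypeCat.ofHom fun t =>
    ⟨fun i => t.1 (h.unop.left i), fun i => by
      have h1 := ConcreteCategory.congr_hom (Over.w h.unop) i
      dsimp at h1
      rw [← h1]
      exact t.2 _⟩
  map_id S := ConcreteCategory.hom_ext _ _ fun t => Subtype.ext rfl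
  map_comp f g := ConcreteCategory.hom_ext _ _ fun t => Subtype.ext rfl

/-- The tuple functor is represented by the signature `{(x, y) // r x y} → X`. -/
def tupIso {X : Type u} (Y : Type u) (r : X → Y → Prop) :
    yoneda.obj (Over.mk (TypeCat.ofHom fun p : { p : X × Y // r p.1 p.2 } => p.1.1)) ≅ tup Y r :=
  NatIso.ofComponents
    (fun S =>
      { hom := TypeCat.ofHom fun f => ⟨fun i => (f.left i).1.2, fun i => by
          have h1 : (f.left i).1.1 = S.unop.hom i := by
            have h0 := ConcreteCategory.congr_hom (Over.w f) i
            exact h0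
          rw [← h1]
          exact (f.left i).2⟩
        inv := TypeCat.ofHom fun t =>
          Over.homMk (TypeCat.ofHom fun i => ⟨(S.unop.hom i, t.1 i), t.2 i⟩) rfl
        hom_inv_id := by
          refine ConcreteCategory.hom_ext _ _ fun f => ?_
          refine Over.OverMorphism.ext ?_
          refine ConcreteCategory.hom_ext _ _ fun i => ?_
          have h1 : (f.left i).1.1 = S.unop.hom i := by
            have h0 := ConcreteCategory.congr_hom (Over.w f) i
            exact h0
          exact Subtype.ext (Prod.ext h1.symm rfl)
        inv_hom_id := ConcreteCategory.hom_ext _ _ fun t => Subtype.ext rfl })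
    (fun f => ConcreteCategory.hom_ext _ _ fun t => Subtype.ext rfl)

/-- For every type domain `(X, Y, r)`, the table category
`Tbl(X,Y,r) = Comma (𝟭 (Type u)) (tup Y r)` has all small limits and all small colimits. -/
theorem tableCategory_hasLimits_hasColimits (X Y : Type u) (r : X → Y → Prop) :
    HasLimitsOfSize.{u, u} (Comma (𝟭 (Type u)) (tup Y r)) ∧
      HasColimitsOfSize.{u, u} (Comma (𝟭 (Type u)) (tup Y r)) := by
  have : PreservesLimitsOfSize.{u, u} (tup Y r) :=
    preservesLimits_of_natIso (tupIso Y r)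
  have : HasColimitsOfSize.{u, u} (Over X) := inferInstance
  have : HasLimitsOfSize.{u, u} (Over X) := inferInstance
  have : HasColimitsOfSize.{u, u} (Over X)ᵒᵖ := inferInstance
  have : HasLimitsOfSize.{u, u} (Over X)ᵒᵖ := inferInstance
  exact ⟨inferInstance, inferInstance⟩
end

section
/- Let F : A ⥤ B and G : B ⥤ A be functors with an adjunction F ⊣ G. Then the functor Grothendieck G_A ⥤ Grothendieck G_B sending (R, D) to (R, D ⋙ F) (induced via Grothendieck.map by the natural transformation G_A ⟶ G_B whose components are post-composition with F) is left adjoint to the functor Grothendieck G_B ⥤ Grothendieck G_A sending (R, E) to (R, E ⋙ G) (induced by post-composition with G). -/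
open CategoryTheory CategoryTheory.Limits

universe w v u

/-- Post-composition with `H : A ⥤ B` as a natural transformation between diagram context
functors, with component at a small category `B₀` the right-whiskering functor
`(B₀ ⥤ A) ⥤ (B₀ ⥤ B)`. -/
@[simps]
def postcompNat {A : Type u} [Category.{v} A] {B : Type u} [Category.{v} B] (H : A ⥤ B) :
    diagramContextFunctor.{w} A ⟶ diagramContextFunctor.{w} B where
  app B₀ := ((Functor.whiskeringRight B₀.unop A B).obj H).toCatHom

/-- The component at `b` of the fiber part of a morphism of diagrams. -/
def dcApp {A : Type u} [Category.{v} A] {X Y : Grothendieck (diagramContextFunctor.{w} A)}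
    (f : X ⟶ Y) (b : Y.base.unop) :
    (show X.base.unop ⥤ A from X.fiber).obj (f.base.unop.toFunctor.obj b) ⟶
      (show Y.base.unop ⥤ A from Y.fiber).obj b :=
  NatTrans.app (C := Y.base.unop) (D := A) f.fiber b

theorem dc_ext {A : Type u} [Category.{v} A] {X Y : Grothendieck (diagramContextFunctor.{w} A)}
    (k : X.base ⟶ Y.base)
    (φ ψ : ((diagramContextFunctor.{w} A).map k).toFunctor.obj X.fiber ⟶ Y.fiber)
    (h : ∀ b : Y.base.unop, dcApp (X := X) (Y := Y) ⟨k, φ⟩ b = dcApp (X := X) (Y := Y) ⟨k, ψ⟩ b) :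
    (⟨k, φ⟩ : Grothendieck.Hom X Y) = ⟨k, ψ⟩ := by
  have : φ = ψ := NatTrans.ext (funext h)
  rw [this]

theorem dcApp_comp {A : Type u} [Category.{v} A]
    {X Y Z : Grothendieck (diagramContextFunctor.{w} A)}
    (f : X ⟶ Y) (g : Y ⟶ Z) (b : Z.base.unop) :
    dcApp (f ≫ g) b = dcApp f (g.base.unop.toFunctor.obj b) ≫ dcApp g b :=
  Category.id_comp (obj := A) _

theorem dcApp_map {A : Type u} [Category.{v} A] {B : Type u} [Category.{v} B] (H : A ⥤ B)
    {X Y : Grothendieck (diagramContextFunctor.{w} A)} (f : X ⟶ Y) (b : Y.base.unop) :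
    dcApp ((Grothendieck.map (postcompNat.{w} H)).map f) b = H.map (dcApp f b) :=
  Category.id_comp (obj := B) _

theorem dcApp_naturality {A : Type u} [Category.{v} A]
    {X Y : Grothendieck (diagramContextFunctor.{w} A)}
    (f : X ⟶ Y) {b c : Y.base.unop} (g : b ⟶ c) :
    (show X.base.unop ⥤ A from X.fiber).map (f.base.unop.toFunctor.map g) ≫ dcApp f c =
      dcApp f b ≫ (show Y.base.unop ⥤ A from Y.fiber).map g :=
  NatTrans.naturality (C := Y.base.unop) (D := A) f.fiber g

/-- Morphisms of diagrams from components. -/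
def dcMk {A : Type u} [Category.{v} A] {X Y : Grothendieck (diagramContextFunctor.{w} A)}
    (k : X.base ⟶ Y.base)
    (φ : k.unop.toFunctor ⋙ (show X.base.unop ⥤ A from X.fiber) ⟶
      (show Y.base.unop ⥤ A from Y.fiber)) : X ⟶ Y :=
  ⟨k, φ⟩

/-- The hom-set bijection of the induced adjunction. -/
def dcHomEquiv {A : Type u} [Category.{v} A] {B : Type u}
    [Category.{v} B] (F : A ⥤ B) (G : B ⥤ A) (adj : F ⊣ G)
    (X : Grothendieck (diagramContextFunctor.{w} A))
    (Y : Grothendieck (diagramContextFunctor.{w} B)) :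
    ((Grothendieck.map (postcompNat.{w} F)).obj X ⟶ Y) ≃
      (X ⟶ (Grothendieck.map (postcompNat.{w} G)).obj Y) where
  toFun f := dcMk (Y := (Grothendieck.map (postcompNat.{w} G)).obj Y) f.base
    { app := fun b => adj.homEquiv _ _ (dcApp f b)
      naturality := fun _ _ g =>
        (adj.homEquiv_naturality_left _ _).symm.trans
          ((congrArg (adj.homEquiv _ _) (dcApp_naturality f g)).trans
            (adj.homEquiv_naturality_right _ _)) }
  invFun f := dcMk (X := (Grothendieck.map (postcompNat.{w} F)).obj X) f.base
    { app := fun b => (adj.homEquiv _ _).symm (dcApp f b)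
      naturality := fun _ _ g =>
        (adj.homEquiv_naturality_left_symm _ _).symm.trans
          ((congrArg (adj.homEquiv _ _).symm (dcApp_naturality f g)).trans
            (adj.homEquiv_naturality_right_symm _ _)) }
  left_inv f := dc_ext _ _ _ fun b => (adj.homEquiv _ _).symm_apply_apply (dcApp f b)
  right_inv f := dc_ext _ _ _ fun b => (adj.homEquiv _ _).apply_symm_apply (dcApp f b)

/-- An adjunction `F ⊣ G` induces an adjunction between the diagram
contexts: the functor `(R, D) ↦ (R, D ⋙ F)` is left adjoint to `(R, E) ↦ (R, E ⋙ G)`. -/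
theorem diagramContext_map_adjunction {A : Type u} [Category.{v} A] {B : Type u}
    [Category.{v} B] (F : A ⥤ B) (G : B ⥤ A) (adj : F ⊣ G) :
    Nonempty (Grothendieck.map (postcompNat.{w} F) ⊣ Grothendieck.map (postcompNat.{w} G)) := by
  refine ⟨Adjunction.mkOfHomEquiv
    { homEquiv := dcHomEquiv F G adj
      homEquiv_naturality_left_symm := ?_
      homEquiv_naturality_right := ?_ }⟩
  · intro X' X Y f g
    refine dc_ext _ _ _ fun b => ?_
    refine (congrArg (adj.homEquiv _ _).symm (dcApp_comp f g b)).trans ?_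
    refine (adj.homEquiv_naturality_left_symm _ _).trans ?_
    refine Eq.trans ?_ (dcApp_comp ((Grothendieck.map (postcompNat.{w} F)).map f)
      ((dcHomEquiv F G adj X Y).symm g) b).symm
    exact congrArg (fun t => t ≫ (adj.homEquiv _ _).symm (dcApp g b))
      (dcApp_map F f (g.base.unop.toFunctor.obj b)).symm
  · intro X Y Y' f g
    refine dc_ext _ _ _ fun b => ?_
    refine (congrArg (adj.homEquiv _ _) (dcApp_comp f g b)).trans ?_
    refine (adj.homEquiv_naturality_right _ _).trans ?_
    refine Eq.trans ?_ (dcApp_comp (dcHomEquiv F G adj X Y f)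
      ((Grothendieck.map (postcompNat.{w} G)).map g) b).symm
    exact congrArg (fun t => adj.homEquiv _ _ (dcApp f (g.base.unop.toFunctor.obj b)) ≫ t)
      (dcApp_map G g b).symm
end

section
/- Let A be a category, B₁ and B₂ small categories, and D₁ : B₁ ⥤ A, D₂ : B₂ ⥤ A diagrams. In the diagram context Grothendieck G_A, the object consisting of the sum category B₁ ⊕ B₂ and the copairing functor [D₁, D₂] : B₁ ⊕ B₂ ⥤ A, together with the two morphisms to (B₁, D₁) and (B₂, D₂) given respectively by the inclusion functors B₁ ⥤ B₁ ⊕ B₂ and B₂ ⥤ B₁ ⊕ B₂ with identity natural transformations, is a binary product of (B₁, D₁) and (B₂, D₂). (In the paper's convention this is the binary coproduct of databases in the opposite of the database context, combining the two databases in an independent union.) -/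
open CategoryTheory CategoryTheory.Limits

universe w v u

variable {A : Type u} [Category.{v} A] {B₁ B₂ : Type w} [Category.{w} B₁] [Category.{w} B₂]

/-- The copairing `[D₁, D₂] : B₁ ⊕ B₂ ⥤ A` of two functors `D₁ : B₁ ⥤ A` and
`D₂ : B₂ ⥤ A`, restricting to `D₁` on the first summand and to `D₂` on the second. -/
def copair (D₁ : B₁ ⥤ A) (D₂ : B₂ ⥤ A) : B₁ ⊕ B₂ ⥤ A where
  obj X :=
    match X with
    | .inl b => D₁.obj b
    | .inr b => D₂.obj b
  map {X Y} f :=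
    match X, Y, f with
    | .inl _, .inl _, f => D₁.map f.down
    | .inr _, .inr _, f => D₂.map f.down
  map_id X := by
    cases X
    · exact D₁.map_id _
    · exact D₂.map_id _
  map_comp {X Y Z} f g :=
    match X, Y, Z, f, g with
    | .inl _, .inl _, .inl _, f, g => D₁.map_comp f.down g.down
    | .inr _, .inr _, .inr _, f, g => D₂.map_comp f.down g.down

/-- The object of the diagram context given by the sum category and the copairing. -/
def sumDiagram (D₁ : B₁ ⥤ A) (D₂ : B₂ ⥤ A) : Grothendieck (diagramContextFunctor.{w} A) :=
  ⟨Opposite.op (Cat.of (B₁ ⊕ B₂)), copair D₁ D₂⟩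

/-- The first projection morphism, given by the inclusion functor `B₁ ⥤ B₁ ⊕ B₂` together
with the identity natural transformation. -/
def sumProj₁ (D₁ : B₁ ⥤ A) (D₂ : B₂ ⥤ A) :
    sumDiagram D₁ D₂ ⟶ (⟨Opposite.op (Cat.of B₁), D₁⟩ :
      Grothendieck (diagramContextFunctor.{w} A)) :=
  ⟨Quiver.Hom.op (X := Cat.of B₁) (Y := Cat.of (B₁ ⊕ B₂)) (Functor.toCatHom (Sum.inl_ B₁ B₂)), 𝟙 D₁⟩

/-- The second projection morphism, given by the inclusion functor `B₂ ⥤ B₁ ⊕ B₂` together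
with the identity natural transformation. -/
def sumProj₂ (D₁ : B₁ ⥤ A) (D₂ : B₂ ⥤ A) :
    sumDiagram D₁ D₂ ⟶ (⟨Opposite.op (Cat.of B₂), D₂⟩ :
      Grothendieck (diagramContextFunctor.{w} A)) :=
  ⟨Quiver.Hom.op (X := Cat.of B₂) (Y := Cat.of (B₁ ⊕ B₂)) (Functor.toCatHom (Sum.inr_ B₁ B₂)), 𝟙 D₂⟩


theorem copair_eta (K : B₁ ⊕ B₂ ⥤ A) :
    K = copair (Sum.inl_ B₁ B₂ ⋙ K) (Sum.inr_ B₁ B₂ ⋙ K) := by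
  refine CategoryTheory.Functor.ext (by rintro (a | b) <;> rfl) ?_
  rintro (a | a) (b | b) f
  · exact ((Category.id_comp _).trans (Category.comp_id _)).symm
  · exact (CategoryTheory.hom_inl_inr_false _ _ f).elim
  · exact (CategoryTheory.hom_inr_inl_false _ _ f).elim
  · exact ((Category.id_comp _).trans (Category.comp_id _)).symm

theorem inl_copair (D₁ : B₁ ⥤ A) (D₂ : B₂ ⥤ A) : Sum.inl_ B₁ B₂ ⋙ copair D₁ D₂ = D₁ := rfl

theorem inr_copair (D₁ : B₁ ⥤ A) (D₂ : B₂ ⥤ A) : Sum.inr_ B₁ B₂ ⋙ copair D₁ D₂ = D₂ := rfl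

/-- Natural transformations into a copairing. -/
def copairLift {D₁ : B₁ ⥤ A} {D₂ : B₂ ⥤ A} (F : B₁ ⊕ B₂ ⥤ A)
    (α : Sum.inl_ B₁ B₂ ⋙ F ⟶ D₁) (β : Sum.inr_ B₁ B₂ ⋙ F ⟶ D₂) : F ⟶ copair D₁ D₂ where
  app X :=
    match X with
    | .inl b => α.app b
    | .inr b => β.app b
  naturality := by
    rintro (a | a) (b | b) f
    · exact α.naturality f.down
    · exact (CategoryTheory.hom_inl_inr_false _ _ f).elim
    · exact (CategoryTheory.hom_inr_inl_false _ _ f).elim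
    · exact β.naturality f.down

/-- Concrete constructor of morphisms of the diagram context. -/
def mkHom (X : Grothendieck (diagramContextFunctor.{w} A)) {B : Type w} [Category.{w} B]
    (D : B ⥤ A) (K : B ⥤ X.base.unop)
    (α : K ⋙ (show X.base.unop ⥤ A from X.fiber) ⟶ D) :
    X ⟶ (⟨Opposite.op (Cat.of B), D⟩ : Grothendieck (diagramContextFunctor.{w} A)) :=
  ⟨Quiver.Hom.op (X := Cat.of B) (Y := X.base.unop) (Functor.toCatHom K), α⟩

theorem mkHom_surj (X : Grothendieck (diagramContextFunctor.{w} A)) {B : Type w} [Category.{w} B]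
    (D : B ⥤ A)
    (f : X ⟶ (⟨Opposite.op (Cat.of B), D⟩ : Grothendieck (diagramContextFunctor.{w} A))) :
    ∃ K α, f = mkHom X D K α := ⟨f.base.unop.toFunctor, f.fiber, rfl⟩

theorem mkHom_proj₁ (X : Grothendieck (diagramContextFunctor.{w} A)) (D₁ : B₁ ⥤ A) (D₂ : B₂ ⥤ A)
    (K : B₁ ⊕ B₂ ⥤ X.base.unop)
    (α : K ⋙ (show X.base.unop ⥤ A from X.fiber) ⟶ copair D₁ D₂) :
    (mkHom X (copair D₁ D₂) K α : X ⟶ sumDiagram D₁ D₂) ≫ sumProj₁ D₁ D₂ =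
      mkHom X D₁ (Sum.inl_ B₁ B₂ ⋙ K) (Functor.whiskerLeft (Sum.inl_ B₁ B₂) α) := by
  refine congrArg (Grothendieck.Hom.mk _) ?_
  exact (Category.id_comp _).trans (Category.comp_id _)

theorem mkHom_proj₂ (X : Grothendieck (diagramContextFunctor.{w} A)) (D₁ : B₁ ⥤ A) (D₂ : B₂ ⥤ A)
    (K : B₁ ⊕ B₂ ⥤ X.base.unop)
    (α : K ⋙ (show X.base.unop ⥤ A from X.fiber) ⟶ copair D₁ D₂) :
    (mkHom X (copair D₁ D₂) K α : X ⟶ sumDiagram D₁ D₂) ≫ sumProj₂ D₁ D₂ =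
      mkHom X D₂ (Sum.inr_ B₁ B₂ ⋙ K) (Functor.whiskerLeft (Sum.inr_ B₁ B₂) α) := by
  refine congrArg (Grothendieck.Hom.mk _) ?_
  exact (Category.id_comp _).trans (Category.comp_id _)

theorem mkHom_base (X : Grothendieck (diagramContextFunctor.{w} A)) {B : Type w} [Category.{w} B]
    {D : B ⥤ A} {K K' : B ⥤ X.base.unop} {α α'} (h : mkHom X D K α = mkHom X D K' α') :
    K = K' :=
  congrArg (fun f : X ⟶ (⟨Opposite.op (Cat.of B), D⟩ : Grothendieck (diagramContextFunctor.{w} A)) =>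
    f.base.unop.toFunctor) h

theorem mkHom_fiber (X : Grothendieck (diagramContextFunctor.{w} A)) {B : Type w} [Category.{w} B]
    {D : B ⥤ A} {K : B ⥤ X.base.unop} {α α'} (h : mkHom X D K α = mkHom X D K α') :
    α = α' := by
  have h' : Grothendieck.Hom.mk _ _ = Grothendieck.Hom.mk _ _ := h
  exact eq_of_heq (Grothendieck.Hom.mk.inj h').2

theorem sumDiagram_hom_ext (X : Grothendieck (diagramContextFunctor.{w} A))
    (D₁ : B₁ ⥤ A) (D₂ : B₂ ⥤ A) (f g : X ⟶ sumDiagram D₁ D₂)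
    (h₁ : f ≫ sumProj₁ D₁ D₂ = g ≫ sumProj₁ D₁ D₂)
    (h₂ : f ≫ sumProj₂ D₁ D₂ = g ≫ sumProj₂ D₁ D₂) : f = g := by
  obtain ⟨K, α, rfl⟩ := mkHom_surj X (copair D₁ D₂) f
  obtain ⟨L, β, rfl⟩ := mkHom_surj X (copair D₁ D₂) g
  have h₁ := (mkHom_proj₁ X D₁ D₂ K α).symm.trans (h₁.trans (mkHom_proj₁ X D₁ D₂ L β))
  have h₂ := (mkHom_proj₂ X D₁ D₂ K α).symm.trans (h₂.trans (mkHom_proj₂ X D₁ D₂ L β))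
  have hK : K = L := by
    rw [copair_eta K, copair_eta L, mkHom_base X h₁, mkHom_base X h₂]
  subst hK
  have e₁ := mkHom_fiber X h₁
  have e₂ := mkHom_fiber X h₂
  have : α = β := by
    apply NatTrans.ext
    funext x
    rcases x with b | b
    · exact congrArg (fun t => NatTrans.app t b) e₁
    · exact congrArg (fun t => NatTrans.app t b) e₂
  rw [this]

theorem sumDiagram_lift (X : Grothendieck (diagramContextFunctor.{w} A))
    (D₁ : B₁ ⥤ A) (D₂ : B₂ ⥤ A)
    (f : X ⟶ (⟨Opposite.op (Cat.of B₁), D₁⟩ : Grothendieck (diagramContextFunctor.{w} A)))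
    (g : X ⟶ (⟨Opposite.op (Cat.of B₂), D₂⟩ : Grothendieck (diagramContextFunctor.{w} A))) :
    ∃ l : X ⟶ sumDiagram D₁ D₂, l ≫ sumProj₁ D₁ D₂ = f ∧ l ≫ sumProj₂ D₁ D₂ = g := by
  obtain ⟨K, α, rfl⟩ := mkHom_surj X D₁ f
  obtain ⟨L, β, rfl⟩ := mkHom_surj X D₂ g
  exact ⟨mkHom X (copair D₁ D₂) (copair K L) (copairLift _ α β),
    mkHom_proj₁ X D₁ D₂ _ _, mkHom_proj₂ X D₁ D₂ _ _⟩

/-- In the diagram context over `A`, the object consisting of the sum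
category `B₁ ⊕ B₂` with the copairing functor `[D₁, D₂] : B₁ ⊕ B₂ ⥤ A`, together with the
two morphisms to `(B₁, D₁)` and `(B₂, D₂)` given by the inclusion functors and identity
natural transformations, is a binary product of `(B₁, D₁)` and `(B₂, D₂)`. -/
theorem sum_isBinaryProduct_in_diagramContext (D₁ : B₁ ⥤ A) (D₂ : B₂ ⥤ A) :
    Nonempty (IsLimit (BinaryFan.mk (sumProj₁ D₁ D₂) (sumProj₂ D₁ D₂))) := by
  choose l h₁ h₂ using fun X => sumDiagram_lift X D₁ D₂
  exact ⟨BinaryFan.isLimitMk (fun s => l s.pt s.fst s.snd) (fun s => h₁ _ _ _)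
    (fun s => h₂ _ _ _) (fun s m e₁ e₂ => sumDiagram_hom_ext _ D₁ D₂ _ _
      (e₁.trans (h₁ _ _ _).symm) (e₂.trans (h₂ _ _ _).symm))⟩
end
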